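/- There exist a bounded smooth vector field 𝐮 : ℝ² → ℝ² and a smooth function p : ℝ² → ℝ such that (𝐮·∇)𝐮 = −∇p and div 𝐮 = 0 in ℝ², 𝐮(x) ≠ 0 for every x ∈ ℝ², and 𝐮 is not a shear flow: there do not exist a unit vector e = (e₁, e₂) ∈ ℝ² and a function U : ℝ → ℝ such that 𝐮(x) = U(x·e⊥) e for all x ∈ ℝ², where e⊥ = (−e₂, e₁). -/

import Mathlib

open MeasureTheory

/-- Partial derivative of `u : ℝ² → ℝ` in the first coordinate. -/
noncomputable def pd1 (u : ℝ × ℝ → ℝ) (p : ℝ × ℝ) : ℝ := fderiv ℝ u p (1, 0)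

/-- Partial derivative of `u : ℝ² → ℝ` in the second coordinate. -/
noncomputable def pd2 (u : ℝ × ℝ → ℝ) (p : ℝ × ℝ) : ℝ := fderiv ℝ u p (0, 1)

/-- Laplacian of `u : ℝ² → ℝ`. -/
noncomputable def lap2 (u : ℝ × ℝ → ℝ) (p : ℝ × ℝ) : ℝ :=
  fderiv ℝ (pd1 u) p (1, 0) + fderiv ℝ (pd2 u) p (0, 1)

/-- Gradient of `u : ℝ² → ℝ`. -/
noncomputable def grad2 (u : ℝ × ℝ → ℝ) (p : ℝ × ℝ) : ℝ × ℝ := (pd1 u p, pd2 u p)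

namespace EulerPlane

open Set Filter Topology

/-- Bounded continuous real functions on the line. -/
abbrev BC := BoundedContinuousFunction ℝ ℝ

lemma hasDerivAt_integral_Iic {f : ℝ → ℝ} (hf : Continuous f)
    (hi : ∀ t, IntegrableOn f (Iic t)) (t : ℝ) :
    HasDerivAt (fun t => ∫ s in Iic t, f s) (f t) t := by
  have h1 : (fun t => ∫ s in Iic t, f s)
      = fun u => (∫ s in Iic 0, f s) + ∫ s in (0 : ℝ)..u, f s := by
    funext u
    rw [← intervalIntegral.integral_Iic_sub_Iic (hi 0) (hi u)]; ring
  rw [h1]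
  exact ((hf.integral_hasStrictDerivAt 0 t).hasDerivAt).const_add _

lemma integrableOn_exp_mul_bc {κ : ℝ} (hκ : 0 < κ) (h : BC) (t : ℝ) :
    IntegrableOn (fun s => Real.exp (κ * s) * h s) (Iic t) := by
  refine Integrable.mul_bdd (c := ‖h‖) (integrableOn_exp_mul_Iic hκ t)
    h.continuous.aestronglyMeasurable ?_
  exact Eventually.of_forall fun s => h.norm_coe_le_norm s

lemma abs_integral_exp_mul_le {κ : ℝ} (hκ : 0 < κ) (h : BC) (t : ℝ) :
    |∫ s in Iic t, Real.exp (κ * s) * h s| ≤ Real.exp (κ * t) / κ * ‖h‖ := by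
  rw [← integral_exp_mul_Iic hκ t, ← integral_mul_const, ← Real.norm_eq_abs]
  refine norm_integral_le_of_norm_le ((integrableOn_exp_mul_Iic hκ t).mul_const _) ?_
  refine Eventually.of_forall fun s => ?_
  rw [norm_mul, Real.norm_of_nonneg (Real.exp_pos _).le]
  exact mul_le_mul_of_nonneg_left (h.norm_coe_le_norm s) (Real.exp_pos _).le

/-- The bounded solution of `z' = h - κ z`. -/
noncomputable def expInt (κ : ℝ) (h : ℝ → ℝ) (t : ℝ) : ℝ :=
  Real.exp (-(κ * t)) * ∫ s in Iic t, Real.exp (κ * s) * h s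

lemma hasDerivAt_expInt {κ : ℝ} (hκ : 0 < κ) (h : BC) (t : ℝ) :
    HasDerivAt (expInt κ h) (h t - κ * expInt κ h t) t := by
  have h1 := hasDerivAt_integral_Iic (f := fun s => Real.exp (κ * s) * h s)
    (by fun_prop) (integrableOn_exp_mul_bc hκ h) t
  have h2 : HasDerivAt (fun t => Real.exp (-(κ * t))) (Real.exp (-(κ * t)) * -(κ * 1)) t :=
    (((hasDerivAt_id t).const_mul κ).neg).exp
  have h3 : HasDerivAt (expInt κ h) _ t := h2.mul h1
  have h4 : Real.exp (-(κ * t)) * Real.exp (κ * t) = 1 := by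
    rw [← Real.exp_add]; simp
  refine h3.congr_deriv ?_
  unfold expInt
  linear_combination (h t) * h4

lemma abs_expInt_le {κ : ℝ} (hκ : 0 < κ) (h : BC) (t : ℝ) :
    |expInt κ h t| ≤ κ⁻¹ * ‖h‖ := by
  unfold expInt
  rw [abs_mul, abs_of_pos (Real.exp_pos _)]
  have h4 : Real.exp (-(κ * t)) * Real.exp (κ * t) = 1 := by
    rw [← Real.exp_add]; simp
  calc _ ≤ Real.exp (-(κ * t)) * (Real.exp (κ * t) / κ * ‖h‖) :=
        mul_le_mul_of_nonneg_left (abs_integral_exp_mul_le hκ h t) (Real.exp_pos _).le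
    _ = κ⁻¹ * ‖h‖ := by rw [div_eq_mul_inv]; linear_combination (κ⁻¹ * ‖h‖) * h4

/-- `expInt` as a bounded operator. -/
noncomputable def expIntL {κ : ℝ} (hκ : 0 < κ) : BC →L[ℝ] BC :=
  LinearMap.mkContinuous
    { toFun := fun h => BoundedContinuousFunction.ofNormedAddCommGroup (expInt κ h)
        (continuous_iff_continuousAt.2 fun t => (hasDerivAt_expInt hκ h t).continuousAt)
        (κ⁻¹ * ‖h‖) (abs_expInt_le hκ h)
      map_add' := fun f g => by
        ext t
        simp only [BoundedContinuousFunction.coe_ofNormedAddCommGroup,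
          BoundedContinuousFunction.coe_add, expInt, Pi.add_apply, mul_add]
        rw [integral_add (integrableOn_exp_mul_bc hκ f t) (integrableOn_exp_mul_bc hκ g t)]
        ring
      map_smul' := fun c f => by
        ext t
        simp only [BoundedContinuousFunction.coe_ofNormedAddCommGroup,
          BoundedContinuousFunction.coe_smul, expInt, smul_eq_mul, RingHom.id_apply]
        rw [show (fun s => Real.exp (κ * s) * (c * f s))
          = fun s => c * (Real.exp (κ * s) * f s) by funext s; ring, integral_const_mul]
        ring }
    κ⁻¹ fun h => (BoundedContinuousFunction.norm_le (by positivity)).2 (abs_expInt_le hκ h)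

lemma expIntL_apply {κ : ℝ} (hκ : 0 < κ) (h : BC) (t : ℝ) : expIntL hκ h t = expInt κ h t := rfl

lemma norm_expIntL_le {κ : ℝ} (hκ : 0 < κ) (h : BC) : ‖expIntL hκ h‖ ≤ κ⁻¹ * ‖h‖ :=
  (BoundedContinuousFunction.norm_le (by positivity)).2 (abs_expInt_le hκ h)

/-- Reflection `t ↦ -t` on bounded continuous functions. -/
noncomputable def reflL : BC →L[ℝ] BC :=
  LinearMap.mkContinuous
    { toFun := fun h => h.compContinuous ⟨fun t => -t, continuous_neg⟩
      map_add' := fun f g => by ext t; simp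
      map_smul' := fun c f => by ext t; simp }
    1 fun h => (BoundedContinuousFunction.norm_le (by positivity)).2 fun t => by
      simpa using h.norm_coe_le_norm (-t)

lemma reflL_apply (h : BC) (t : ℝ) : reflL h t = h (-t) := rfl

lemma norm_reflL_le (h : BC) : ‖reflL h‖ ≤ ‖h‖ :=
  (BoundedContinuousFunction.norm_le (by positivity)).2 fun t => h.norm_coe_le_norm (-t)

/-- The bounded solution operator of `v'' = κ² v + h`. -/
lemma exists_resolvent {κ : ℝ} (hκ : 0 < κ) :
    ∃ R R1 : BC →L[ℝ] BC, (∀ h, ‖R h‖ ≤ ‖h‖ / κ ^ 2) ∧ (∀ h, ‖R1 h‖ ≤ 2 * ‖h‖ / κ) ∧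
      ∀ h t, HasDerivAt (R h) (R1 h t) t ∧ HasDerivAt (R1 h) (κ ^ 2 * R h t + h t) t := by
  set E := expIntL hκ
  set R : BC →L[ℝ] BC := -(reflL ∘L E ∘L reflL ∘L E) with hR
  have hRn : ∀ h, ‖R h‖ ≤ ‖h‖ / κ ^ 2 := fun h => by
    have h1 := norm_reflL_le (E (reflL (E h)))
    have h2 := norm_expIntL_le hκ (reflL (E h))
    have h3 := norm_reflL_le (E h)
    have h4 := norm_expIntL_le hκ h
    have h5 : ‖R h‖ = ‖reflL (E (reflL (E h)))‖ := by simp [hR]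
    rw [h5]
    calc _ ≤ κ⁻¹ * (κ⁻¹ * ‖h‖) :=
          (h1.trans h2).trans (mul_le_mul_of_nonneg_left (h3.trans h4) (by positivity))
      _ = _ := by field_simp
  have hd : ∀ h t, HasDerivAt (R h) (κ * R h t + E h t) t := fun h t => by
    have h1 := hasDerivAt_expInt hκ (reflL (E h)) (-t)
    have h2 : HasDerivAt (R h) _ t := (h1.comp t (hasDerivAt_neg t)).neg
    refine h2.congr_deriv ?_
    simp [hR, reflL_apply, E, expIntL_apply]
    ring
  refine ⟨R, κ • R + E, hRn, fun h => ?_, fun h t => ⟨hd h t, ?_⟩⟩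
  · have h1 := hRn h
    have h2 := norm_expIntL_le hκ h
    calc _ ≤ ‖κ • R h‖ + ‖E h‖ := norm_add_le _ _
      _ ≤ κ * (‖h‖ / κ ^ 2) + κ⁻¹ * ‖h‖ := by
        rw [norm_smul, Real.norm_of_nonneg hκ.le]; gcongr
      _ = _ := by field_simp; ring
  · have h1 := ((hd h t).const_mul κ).add (hasDerivAt_expInt hκ h t)
    refine h1.congr_deriv ?_
    simp only [E, expIntL_apply]; ring

/-- The heteroclinic profile, solving `A' = A - A³`. -/
noncomputable def front (t : ℝ) : ℝ := (Real.sqrt (1 + Real.exp (-2 * t)))⁻¹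

lemma front_pos (t : ℝ) : 0 < front t := by unfold front; positivity

lemma front_sq (t : ℝ) : front t ^ 2 = (1 + Real.exp (-2 * t))⁻¹ := by
  unfold front
  rw [inv_pow, Real.sq_sqrt (by positivity)]

lemma front_lt_one (t : ℝ) : front t < 1 := by
  have h : front t ^ 2 < 1 := by
    rw [front_sq]
    exact inv_lt_one_of_one_lt₀ (by linarith [Real.exp_pos (-2 * t)])
  nlinarith [front_pos t]

lemma hasDerivAt_front (t : ℝ) : HasDerivAt front (front t - front t ^ 3) t := by
  have h0 : 0 < 1 + Real.exp (-2 * t) := by positivity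
  have h1 : HasDerivAt (fun t => 1 + Real.exp (-2 * t)) (Real.exp (-2 * t) * (-2 * 1)) t :=
    (((hasDerivAt_id t).const_mul (-2)).exp).const_add 1
  have h2 : HasDerivAt front _ t := (h1.sqrt h0.ne').inv (by positivity)
  refine h2.congr_deriv ?_
  have h3 := Real.sq_sqrt h0.le
  have h4 : Real.sqrt (1 + Real.exp (-2 * t)) ≠ 0 := by positivity
  unfold front
  generalize Real.exp (-2 * t) = x at *
  have h5 : x = Real.sqrt (1 + x) ^ 2 - 1 := by linarith
  generalize Real.sqrt (1 + x) = r at *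
  subst h5
  field_simp

lemma continuous_front : Continuous front :=
  continuous_iff_continuousAt.2 fun t => (hasDerivAt_front t).continuousAt

lemma front_cube_lt (t : ℝ) : 0 < front t - front t ^ 3 := by
  have h1 := front_pos t
  have h2 := front_lt_one t
  have : front t - front t ^ 3 = front t * (1 - front t) * (1 + front t) := by ring
  rw [this]
  have : 0 < 1 - front t := by linarith
  positivity

lemma front_strictMono : StrictMono front :=
  strictMono_of_deriv_pos fun t => by rw [(hasDerivAt_front t).deriv]; exact front_cube_lt t

lemma front_zero_sq : front 0 ^ 2 = 1 / 2 := by rw [front_sq]; norm_num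

lemma front_sq_le {t : ℝ} (ht : t ≤ 0) : front t ^ 2 ≤ 1 / 2 := by
  rw [← front_zero_sq]
  exact pow_le_pow_left₀ (front_pos t).le (front_strictMono.monotone ht) 2

lemma le_front_sq {t : ℝ} (ht : 0 ≤ t) : 1 / 2 ≤ front t ^ 2 := by
  rw [← front_zero_sq]
  exact pow_le_pow_left₀ (front_pos 0).le (front_strictMono.monotone ht) 2

lemma tendsto_front_atTop : Tendsto front atTop (𝓝 1) := by
  have h1 : Tendsto (fun t : ℝ => Real.exp (-2 * t)) atTop (𝓝 0) :=
    Real.tendsto_exp_atBot.comp (tendsto_id.const_mul_atTop_of_neg (by norm_num))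
  have h2 : Tendsto (fun t : ℝ => (Real.sqrt (1 + Real.exp (-2 * t)))⁻¹) atTop
      (𝓝 (Real.sqrt (1 + 0))⁻¹) := ((h1.const_add 1).sqrt).inv₀ (by norm_num)
  simp only [add_zero, Real.sqrt_one, inv_one] at h2
  exact h2

lemma tendsto_front_atBot : Tendsto front atBot (𝓝 0) := by
  have h1 : Tendsto (fun t : ℝ => Real.exp (-2 * t)) atBot atTop :=
    Real.tendsto_exp_atTop.comp (tendsto_id.const_mul_atBot_of_neg (by norm_num))
  exact (Real.tendsto_sqrt_atTop.comp (tendsto_const_nhds.add_atTop h1)).inv_tendsto_atTop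

/-- The profile as a bounded continuous function. -/
noncomputable def frontBC : BC :=
  BoundedContinuousFunction.ofNormedAddCommGroup front continuous_front 1 fun t => by
    rw [Real.norm_of_nonneg (front_pos t).le]; exact (front_lt_one t).le

@[simp] lemma frontBC_apply (t : ℝ) : frontBC t = front t := rfl

/-- The derivative of the profile. -/
noncomputable def frontD (t : ℝ) : ℝ := front t - front t ^ 3

lemma hasDerivAt_front' (t : ℝ) : HasDerivAt front (frontD t) t := hasDerivAt_front t

lemma frontD_pos (t : ℝ) : 0 < frontD t := front_cube_lt t

lemma hasDerivAt_frontD (t : ℝ) : HasDerivAt frontD ((1 - 3 * front t ^ 2) * frontD t) t := by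
  have h := hasDerivAt_front t
  have h2 : HasDerivAt frontD _ t := h.sub (h.pow 3)
  refine h2.congr_deriv ?_
  unfold frontD; push_cast; ring

lemma continuous_frontD : Continuous frontD :=
  continuous_iff_continuousAt.2 fun t => (hasDerivAt_frontD t).continuousAt

lemma integrable_frontD : Integrable frontD := by
  refine integrable_of_intervalIntegral_norm_bounded (ι := ℝ) (l := atTop) (a := fun x => -x)
    (b := fun x => x) 1
    (fun i => (continuous_frontD.integrableOn_Icc).mono_set Ioc_subset_Icc_self)
    tendsto_neg_atTop_atBot tendsto_id ?_
  refine Eventually.of_forall fun i => ?_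
  have h1 : ∫ x in (-i)..i, ‖frontD x‖ = ∫ x in (-i)..i, frontD x :=
    intervalIntegral.integral_congr fun x _ => Real.norm_of_nonneg (frontD_pos x).le
  rw [h1, intervalIntegral.integral_eq_sub_of_hasDerivAt (fun x _ => hasDerivAt_front' x)
    (continuous_frontD.intervalIntegrable _ _)]
  linarith [front_lt_one i, front_pos (-i)]

lemma integral_frontD_Iic (t : ℝ) : ∫ s in Iic t, frontD s = front t := by
  rw [integral_Iic_of_hasDerivAt_of_tendsto' (fun x _ => hasDerivAt_front' x)
    integrable_frontD.integrableOn tendsto_front_atBot, sub_zero]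

lemma integral_frontD_Ioi (t : ℝ) : ∫ s in Ioi t, frontD s = 1 - front t :=
  integral_Ioi_of_hasDerivAt_of_tendsto' (fun x _ => hasDerivAt_front' x)
    integrable_frontD.integrableOn tendsto_front_atTop

lemma integral_frontD : ∫ s, frontD s = 1 := by
  rw [integral_of_hasDerivAt_of_tendsto hasDerivAt_front' integrable_frontD tendsto_front_atBot
    tendsto_front_atTop, sub_zero]

lemma integrable_frontD_mul (h : BC) : Integrable fun s => frontD s * h s :=
  integrable_frontD.mul_bdd (c := ‖h‖) h.continuous.aestronglyMeasurable
    (Eventually.of_forall fun s => h.norm_coe_le_norm s)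

lemma integral_frontD_mul_pow : ∫ s, frontD s * (frontBC ^ 5 : BC) s = 1 / 6 := by
  have h : ∀ x, HasDerivAt (fun t => front t ^ 6 / 6) (frontD x * (frontBC ^ 5 : BC) x) x := by
    intro x
    refine (((hasDerivAt_front x).pow 6).div_const 6).congr_deriv ?_
    simp [frontD]; ring
  rw [integral_of_hasDerivAt_of_tendsto h (integrable_frontD_mul _)
    ((tendsto_front_atBot.pow 6).div_const 6) ((tendsto_front_atTop.pow 6).div_const 6)]
  norm_num

lemma abs_setIntegral_frontD_mul_le (h : BC) (s : Set ℝ) :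
    |∫ x in s, frontD x * h x| ≤ (∫ x in s, frontD x) * ‖h‖ := by
  rw [← integral_mul_const, ← Real.norm_eq_abs]
  refine norm_integral_le_of_norm_le (integrable_frontD.integrableOn.mul_const _) ?_
  refine Eventually.of_forall fun x => ?_
  rw [norm_mul, Real.norm_of_nonneg (frontD_pos x).le]
  exact mul_le_mul_of_nonneg_left (h.norm_coe_le_norm x) (frontD_pos x).le

lemma abs_integral_frontD_mul_le (h : BC) : |∫ x, frontD x * h x| ≤ ‖h‖ := by
  have := abs_setIntegral_frontD_mul_le h univ
  simpa [integral_frontD] using this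

/-- Integration against the derivative of the profile. -/
noncomputable def frontFun : BC →L[ℝ] ℝ :=
  LinearMap.mkContinuous
    { toFun := fun h => ∫ x, frontD x * h x
      map_add' := fun f g => by
        simp only [BoundedContinuousFunction.coe_add, Pi.add_apply, mul_add]
        exact integral_add (integrable_frontD_mul f) (integrable_frontD_mul g)
      map_smul' := fun c f => by
        simp only [BoundedContinuousFunction.coe_smul, smul_eq_mul, RingHom.id_apply]
        rw [← integral_const_mul]
        congr 1; funext x; ring }
    1 fun h => by simpa using abs_integral_frontD_mul_le h

lemma frontFun_apply (h : BC) : frontFun h = ∫ x, frontD x * h x := rfl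

/-- The bounded solution of `z' = h - p z`, where `p = A''/A'`, for `h` orthogonal to `A'`. -/
noncomputable def frontInt (h : ℝ → ℝ) (t : ℝ) : ℝ := (∫ s in Iic t, frontD s * h s) / frontD t

lemma hasDerivAt_frontInt (h : BC) (t : ℝ) :
    HasDerivAt (frontInt h) (h t - (1 - 3 * front t ^ 2) * frontInt h t) t := by
  have h1 := hasDerivAt_integral_Iic (f := fun s => frontD s * h s)
    (continuous_frontD.mul h.continuous) (fun t => (integrable_frontD_mul h).integrableOn) t
  have h0 := (frontD_pos t).ne'
  have h2 : HasDerivAt (frontInt h) _ t := h1.div (hasDerivAt_frontD t) h0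
  refine h2.congr_deriv ?_
  unfold frontInt
  field_simp

lemma abs_frontInt_le {h : BC} (hh : ∫ x, frontD x * h x = 0) (t : ℝ) :
    |frontInt h t| ≤ 2 * ‖h‖ := by
  have h1 : |∫ s in Iic t, frontD s * h s| ≤ front t * ‖h‖ := by
    rw [← integral_frontD_Iic]; exact abs_setIntegral_frontD_mul_le h _
  have h2 : |∫ s in Iic t, frontD s * h s| ≤ (1 - front t) * ‖h‖ := by
    have h3 := integral_add_compl (measurableSet_Iic (a := t)) (integrable_frontD_mul h)
    rw [hh, compl_Iic] at h3
    rw [eq_neg_of_add_eq_zero_left h3, abs_neg, ← integral_frontD_Ioi]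
    exact abs_setIntegral_frontD_mul_le h _
  unfold frontInt
  rw [abs_div, abs_of_pos (frontD_pos t), div_le_iff₀ (frontD_pos t)]
  have ha := front_pos t
  have hb := front_lt_one t
  have hn := norm_nonneg h
  rcases le_total t 0 with ht | ht
  · refine h1.trans ?_
    have := front_sq_le ht
    have : front t ≤ 2 * frontD t := by unfold frontD; nlinarith
    nlinarith
  · refine h2.trans ?_
    have := le_front_sq ht
    have h6 : 1 / 2 ≤ front t := by nlinarith
    have : 1 - front t ≤ 2 * frontD t := by
      have : 2 * frontD t - (1 - front t) = (1 - front t) * (2 * front t + 2 * front t ^ 2 - 1) := by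
        unfold frontD; ring
      nlinarith [mul_nonneg (sub_nonneg.2 hb.le)
        (show 0 ≤ 2 * front t + 2 * front t ^ 2 - 1 by nlinarith)]
    nlinarith

/-- The bounded solution of `v' = p v + z`, where `p = A''/A'`. -/
noncomputable def frontSol (z : ℝ → ℝ) (t : ℝ) : ℝ := frontD t * ∫ s in (0 : ℝ)..t, z s / frontD s

lemma continuous_div_frontD (z : BC) : Continuous fun s => z s / frontD s :=
  z.continuous.div continuous_frontD fun x => (frontD_pos x).ne'

lemma hasDerivAt_frontSol (z : BC) (t : ℝ) :
    HasDerivAt (frontSol z) ((1 - 3 * front t ^ 2) * frontSol z t + z t) t := by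
  have h1 := ((continuous_div_frontD z).integral_hasStrictDerivAt 0 t).hasDerivAt
  have h0 := (frontD_pos t).ne'
  have h2 : HasDerivAt (frontSol z) _ t := (hasDerivAt_frontD t).mul h1
  refine h2.congr_deriv ?_
  unfold frontSol
  field_simp

lemma hasDerivAt_inv_frontD (t : ℝ) :
    HasDerivAt (fun t => 2 / frontD t) (-2 * (1 - 3 * front t ^ 2) / frontD t) t := by
  have h0 := (frontD_pos t).ne'
  refine (((hasDerivAt_const t (2:ℝ)).div (hasDerivAt_frontD t) h0)).congr_deriv ?_
  field_simp; ring

lemma hasDerivAt_inv_front (t : ℝ) :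
    HasDerivAt (fun t => -(4 / front t)) (4 * frontD t / front t ^ 2) t := by
  have h0 := (front_pos t).ne'
  refine (((hasDerivAt_const t (4:ℝ)).div (hasDerivAt_front t) h0)).neg.congr_deriv ?_
  unfold frontD; field_simp; ring

lemma abs_frontSol_le (z : BC) (t : ℝ) : |frontSol z t| ≤ 4 * ‖z‖ := by
  have hD := frontD_pos t
  have hzc : Continuous fun s => ‖z‖ / frontD s :=
    continuous_const.div continuous_frontD fun x => (frontD_pos x).ne'
  have hb : ∀ s, ‖z s / frontD s‖ ≤ ‖z‖ / frontD s := fun s => by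
    rw [norm_div, Real.norm_of_nonneg (frontD_pos s).le]
    exact div_le_div_of_nonneg_right (z.norm_coe_le_norm s) (frontD_pos s).le
  have hn := norm_nonneg z
  unfold frontSol
  rw [abs_mul, abs_of_pos hD]
  rcases le_total 0 t with ht | ht
  · have h1 : |∫ s in (0 : ℝ)..t, z s / frontD s| ≤ ‖z‖ * (2 / frontD t) := by
      refine (intervalIntegral.norm_integral_le_of_norm_le ht
        (Eventually.of_forall fun s _ => hb s) (hzc.intervalIntegrable _ _)).trans ?_
      have h2 : ∫ s in (0 : ℝ)..t, ‖z‖ / frontD s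
          ≤ ‖z‖ * (2 / frontD t) - ‖z‖ * (2 / frontD 0) := by
        refine intervalIntegral.integral_le_sub_of_hasDeriv_right_of_le ht ?_ (fun x _ =>
          ((hasDerivAt_inv_frontD x).const_mul ‖z‖).hasDerivWithinAt) hzc.integrableOn_Icc ?_
        · exact ((continuous_const.div continuous_frontD
            fun x => (frontD_pos x).ne').const_mul _).continuousOn
        · intro x hx
          have := le_front_sq hx.1.le
          rw [div_eq_mul_inv, div_eq_mul_inv]
          have h5 := inv_pos.2 (frontD_pos x)
          have : 1 * (frontD x)⁻¹ ≤ -2 * (1 - 3 * front x ^ 2) * (frontD x)⁻¹ := by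
            gcongr; linarith
          nlinarith
      have h3 : 0 ≤ ‖z‖ * (2 / frontD 0) := by have := frontD_pos 0; positivity
      linarith
    calc _ ≤ frontD t * (‖z‖ * (2 / frontD t)) := by gcongr
      _ = 2 * ‖z‖ := by field_simp
      _ ≤ _ := by linarith
  · have h1 : |∫ s in (0 : ℝ)..t, z s / frontD s| ≤ ‖z‖ * (4 / front t) := by
      rw [intervalIntegral.integral_symm, abs_neg]
      refine (intervalIntegral.norm_integral_le_of_norm_le ht
        (Eventually.of_forall fun s _ => hb s) (hzc.intervalIntegrable _ _)).trans ?_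
      have h2 : ∫ s in t..(0 : ℝ), ‖z‖ / frontD s
          ≤ ‖z‖ * (-(4 / front 0)) - ‖z‖ * (-(4 / front t)) := by
        refine intervalIntegral.integral_le_sub_of_hasDeriv_right_of_le ht ?_ (fun x _ =>
          ((hasDerivAt_inv_front x).const_mul ‖z‖).hasDerivWithinAt) hzc.integrableOn_Icc ?_
        · exact ((continuous_const.div continuous_front
            fun x => (front_pos x).ne').neg.const_mul _).continuousOn
        · intro x hx
          have h4 := front_sq_le hx.2.le
          have h5 := frontD_pos x
          have h6 := front_pos x
          rw [div_eq_mul_one_div]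
          refine mul_le_mul_of_nonneg_left ?_ hn
          rw [div_le_div_iff₀ h5 (by positivity)]
          have h7 : frontD x = front x * (1 - front x ^ 2) := by unfold frontD; ring
          rw [h7]
          have h8 : 1 ≤ 4 * (1 - front x ^ 2) ^ 2 := by nlinarith
          nlinarith [sq_nonneg (front x)]
      have h3 : 0 ≤ ‖z‖ * (4 / front 0) := by have := front_pos 0; positivity
      linarith
    have h9 : frontD t ≤ front t := by unfold frontD; nlinarith [pow_pos (front_pos t) 3]
    have h6 := front_pos t
    calc _ ≤ frontD t * (‖z‖ * (4 / front t)) := by gcongr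
      _ ≤ front t * (‖z‖ * (4 / front t)) := by gcongr
      _ = 4 * ‖z‖ := by field_simp

lemma continuous_frontInt (h : BC) : Continuous (frontInt h) :=
  continuous_iff_continuousAt.2 fun t => (hasDerivAt_frontInt h t).continuousAt

lemma continuous_frontSol (h : BC) : Continuous (frontSol h) :=
  continuous_iff_continuousAt.2 fun t => (hasDerivAt_frontSol h t).continuousAt

/-- `frontSol` as a bounded operator. -/
noncomputable def frontSolL : BC →L[ℝ] BC :=
  LinearMap.mkContinuous
    { toFun := fun h => BoundedContinuousFunction.ofNormedAddCommGroup (frontSol h)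
        (continuous_frontSol h) (4 * ‖h‖) (abs_frontSol_le h)
      map_add' := fun f g => by
        ext t
        simp only [BoundedContinuousFunction.coe_ofNormedAddCommGroup,
          BoundedContinuousFunction.coe_add, frontSol, Pi.add_apply, add_div]
        rw [intervalIntegral.integral_add ((continuous_div_frontD f).intervalIntegrable _ _)
          ((continuous_div_frontD g).intervalIntegrable _ _)]
        ring
      map_smul' := fun c f => by
        ext t
        simp only [BoundedContinuousFunction.coe_ofNormedAddCommGroup,
          BoundedContinuousFunction.coe_smul, frontSol, smul_eq_mul, RingHom.id_apply, mul_div_assoc]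
        rw [intervalIntegral.integral_const_mul]
        ring }
    4 fun h => (BoundedContinuousFunction.norm_le (by positivity)).2 (abs_frontSol_le h)

lemma frontSolL_apply (h : BC) (t : ℝ) : frontSolL h t = frontSol h t := rfl

/-- The projection onto the orthogonal complement of `A'` along `A⁵`. -/
noncomputable def frontProj : BC →L[ℝ] BC :=
  ContinuousLinearMap.id ℝ BC - frontFun.smulRight ((6 : ℝ) • frontBC ^ 5)

lemma frontProj_apply (h : BC) : frontProj h = h - frontFun h • ((6 : ℝ) • frontBC ^ 5) := rfl

lemma integral_frontProj (h : BC) : ∫ x, frontD x * frontProj h x = 0 := by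
  rw [← frontFun_apply, frontProj_apply, map_sub, map_smul, map_smul, frontFun_apply (_ ^ 5),
    integral_frontD_mul_pow]
  simp

/-- `frontInt ∘ frontProj` as a bounded operator. -/
noncomputable def frontIntL : BC →L[ℝ] BC :=
  LinearMap.mkContinuous
    { toFun := fun h => BoundedContinuousFunction.ofNormedAddCommGroup (frontInt (frontProj h))
        (continuous_frontInt _) (2 * ‖frontProj h‖) (abs_frontInt_le (integral_frontProj h))
      map_add' := fun f g => by
        ext t
        simp only [BoundedContinuousFunction.coe_ofNormedAddCommGroup, map_add,
          BoundedContinuousFunction.coe_add, frontInt, Pi.add_apply, mul_add]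
        rw [integral_add (integrable_frontD_mul _).integrableOn
          (integrable_frontD_mul _).integrableOn]
        ring
      map_smul' := fun c f => by
        ext t
        simp only [BoundedContinuousFunction.coe_ofNormedAddCommGroup, map_smul,
          BoundedContinuousFunction.coe_smul, frontInt, smul_eq_mul, RingHom.id_apply]
        rw [← mul_div_assoc, ← integral_const_mul]
        congr 2; funext x; ring }
    (2 * ‖frontProj‖) fun h => (BoundedContinuousFunction.norm_le (by positivity)).2 fun t => by
      refine (abs_frontInt_le (integral_frontProj h) t).trans ?_
      rw [mul_assoc]
      exact mul_le_mul_of_nonneg_left (frontProj.le_opNorm h) (by norm_num)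

lemma frontIntL_apply (h : BC) (t : ℝ) : frontIntL h t = frontInt (frontProj h) t := rfl

/-- The solution operator of `v'' = (1 - 12 A² + 15 A⁴) v + h + μ k A⁵` with a multiplier `μ`. -/
lemma exists_front_solution {k : ℝ} (hk : k ≠ 0) :
    ∃ (S S1 : BC →L[ℝ] BC) (m : BC →L[ℝ] ℝ), ∀ h t, HasDerivAt (S h) (S1 h t) t ∧
      HasDerivAt (S1 h) ((1 - 12 * front t ^ 2 + 15 * front t ^ 4) * S h t + h t
        + m h * k * front t ^ 5) t := by
  set S := frontSolL ∘L frontIntL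
  set pBC : BC := 1 - (3 : ℝ) • frontBC ^ 2 with hp
  set S1 := (ContinuousLinearMap.mul ℝ BC pBC) ∘L S + frontIntL with hS1
  have hpt : ∀ t, pBC t = 1 - 3 * front t ^ 2 := fun t => by simp [hp]
  have hSd : ∀ h t, HasDerivAt (S h) (S1 h t) t := fun h t => by
    have := hasDerivAt_frontSol (frontIntL h) t
    refine HasDerivAt.congr_deriv (f := S h) this ?_
    simp [hS1, hpt, S, frontSolL_apply]
  have hpd : ∀ t, HasDerivAt pBC (-(6 * front t * frontD t)) t := fun t => by
    have h1 := (((hasDerivAt_front t).pow 2).const_mul 3).const_sub 1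
    have h2 : HasDerivAt pBC _ t := h1
    refine h2.congr_deriv ?_
    unfold frontD; push_cast; ring
  refine ⟨S, S1, (-(6 / k)) • frontFun, fun h t => ⟨hSd h t, ?_⟩⟩
  have h1 : HasDerivAt (S1 h) _ t :=
    ((hpd t).mul (hSd h t)).add (hasDerivAt_frontInt (frontProj h) t)
  refine h1.congr_deriv ?_
  rw [← frontIntL_apply]
  simp only [hS1, frontProj_apply, hpt, frontD]
  simp [hpt]
  field_simp
  ring

/-- Sequences of functions of `t`, indexed by Fourier modes. -/
abbrev Seq := ℤ → ℝ → ℝ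

/-- Cauchy product of sequences. -/
noncomputable def conv (c d : Seq) : Seq := fun m t => ∑' j, c j t * d (m - j) t

/-- The weight on Fourier coefficients. -/
noncomputable def wt (m : ℤ) : ℝ := (1 / 2) ^ m.natAbs / (1 + (m : ℝ) ^ 2)

lemma wt_pos (m : ℤ) : 0 < wt m := by unfold wt; positivity

lemma wt_neg (m : ℤ) : wt (-m) = wt m := by simp [wt]

lemma wt_one : wt 1 = 1 / 4 := by norm_num [wt]

lemma summable_one_div_one_add_sq : Summable fun j : ℤ => 1 / (1 + (j : ℝ) ^ 2) := by
  have h : Summable fun j : ℤ => 1 / (j : ℝ) ^ 2 := by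
    exact Real.summable_one_div_int_pow.2 (by norm_num)
  refine Summable.of_norm_bounded_eventually h ?_
  filter_upwards [(Set.finite_singleton (0 : ℤ)).compl_mem_cofinite] with j hj
  have hj0 : (j : ℝ) ≠ 0 := by exact_mod_cast hj
  rw [Real.norm_of_nonneg (by positivity)]
  exact one_div_le_one_div_of_le (by positivity) (by linarith)

lemma summable_one_div_one_add_sq_sub (m : ℤ) :
    Summable fun j : ℤ => 1 / (1 + ((m - j : ℤ) : ℝ) ^ 2) :=
  ((Equiv.subLeft m).summable_iff
    (f := fun j : ℤ => 1 / (1 + (j : ℝ) ^ 2))).2 summable_one_div_one_add_sq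

/-- The dominating sequence for the weighted Cauchy product. -/
noncomputable def dom (m j : ℤ) : ℝ := 2 * (1 / (1 + (j : ℝ) ^ 2) + 1 / (1 + ((m - j : ℤ) : ℝ) ^ 2))

lemma summable_dom (m : ℤ) : Summable (dom m) :=
  (summable_one_div_one_add_sq.add (summable_one_div_one_add_sq_sub m)).mul_left 2

lemma dom_nonneg (m j : ℤ) : 0 ≤ dom m j := by unfold dom; positivity

/-- The constant of the weighted Cauchy product. -/
noncomputable def convConst : ℝ := 4 * ∑' j : ℤ, 1 / (1 + (j : ℝ) ^ 2)

lemma tsum_dom (m : ℤ) : ∑' j, dom m j = convConst := by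
  unfold dom convConst
  rw [tsum_mul_left, (summable_one_div_one_add_sq.tsum_add (summable_one_div_one_add_sq_sub m))]
  have := (Equiv.subLeft m).tsum_eq (fun j : ℤ => 1 / (1 + (j : ℝ) ^ 2))
  simp only [Equiv.subLeft_apply] at this
  rw [this]; ring

lemma convConst_nonneg : 0 ≤ convConst := by
  rw [← tsum_dom 0]; exact tsum_nonneg (dom_nonneg 0)

lemma one_add_sq_le (m j : ℤ) : 1 + (m : ℝ) ^ 2
    ≤ 2 * (1 + (j : ℝ) ^ 2) + 2 * (1 + ((m - j : ℤ) : ℝ) ^ 2) := by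
  push_cast
  nlinarith [sq_nonneg ((m : ℝ) - 2 * j)]

lemma wt_mul_le (m j : ℤ) : wt j * wt (m - j) ≤ wt m * dom m j := by
  have h1 := one_add_sq_le m j
  have h2 : ((1 : ℝ) / 2) ^ (j.natAbs + (m - j).natAbs) ≤ (1 / 2) ^ m.natAbs :=
    pow_le_pow_of_le_one (by norm_num) (by norm_num) (by omega)
  unfold wt dom
  rw [div_mul_div_comm, ← pow_add, div_mul_eq_mul_div, div_le_div_iff₀ (by positivity)
    (by positivity)]
  set x : ℝ := 1 + (j : ℝ) ^ 2
  set y : ℝ := 1 + ((m - j : ℤ) : ℝ) ^ 2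
  have hx : 0 < x := by positivity
  have hy : 0 < y := by positivity
  have h3 : 2 * (1 / x + 1 / y) * (x * y) = 2 * x + 2 * y := by field_simp; ring
  rw [mul_assoc, h3]
  gcongr

/-- Weighted sequences of bounded continuous functions. -/
abbrev V := BoundedContinuousFunction (ℤ × ℝ) ℝ

/-- The Fourier coefficients of an element of `V`. -/
noncomputable def cf (β : V) : Seq := fun m t => wt m * β (m, t)

lemma abs_cf_le (β : V) (m : ℤ) (t : ℝ) : |cf β m t| ≤ wt m * ‖β‖ := by
  unfold cf
  rw [abs_mul, abs_of_pos (wt_pos m)]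
  exact mul_le_mul_of_nonneg_left (β.norm_coe_le_norm _) (wt_pos m).le

lemma norm_cf_mul_le (β γ : V) (m j : ℤ) (t : ℝ) :
    ‖cf β j t * cf γ (m - j) t‖ ≤ wt m * dom m j * (‖β‖ * ‖γ‖) := by
  rw [norm_mul, Real.norm_eq_abs, Real.norm_eq_abs]
  have h1 := abs_cf_le β j t
  have h2 := abs_cf_le γ (m - j) t
  have h3 := wt_mul_le m j
  calc _ ≤ (wt j * ‖β‖) * (wt (m - j) * ‖γ‖) :=
        mul_le_mul h1 h2 (abs_nonneg _) (mul_nonneg (wt_pos j).le (norm_nonneg _))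
    _ = (wt j * wt (m - j)) * (‖β‖ * ‖γ‖) := by ring
    _ ≤ _ := by gcongr

lemma summable_cf_mul (β γ : V) (m : ℤ) (t : ℝ) :
    Summable fun j => cf β j t * cf γ (m - j) t :=
  Summable.of_norm_bounded (((summable_dom m).mul_left _).mul_right _)
    fun j => norm_cf_mul_le β γ m j t

lemma abs_conv_cf_le (β γ : V) (m : ℤ) (t : ℝ) :
    |conv (cf β) (cf γ) m t| ≤ wt m * (convConst * ‖β‖ * ‖γ‖) := by
  have := tsum_of_norm_bounded (((summable_dom m).mul_left (wt m)).mul_right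
    (‖β‖ * ‖γ‖)).hasSum fun j => norm_cf_mul_le β γ m j t
  rw [tsum_mul_right, tsum_mul_left, tsum_dom] at this
  refine this.trans (le_of_eq ?_); ring

lemma continuous_cf (β : V) (m : ℤ) : Continuous (cf β m) := by
  unfold cf; fun_prop

lemma continuous_conv_cf (β γ : V) (m : ℤ) : Continuous (conv (cf β) (cf γ) m) :=
  continuous_tsum (fun j => (continuous_cf β j).mul (continuous_cf γ (m - j)))
    (((summable_dom m).mul_left _).mul_right _) fun j t => norm_cf_mul_le β γ m j t

lemma mulV_bound (β γ : V) (p : ℤ × ℝ) :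
    ‖(wt p.1)⁻¹ * conv (cf β) (cf γ) p.1 p.2‖ ≤ convConst * ‖β‖ * ‖γ‖ := by
  have hw := wt_pos p.1
  rw [norm_mul, Real.norm_of_nonneg (inv_pos.2 hw).le, inv_mul_le_iff₀ hw]
  exact abs_conv_cf_le β γ p.1 p.2

/-- The product of `V`. -/
noncomputable def mulV (β γ : V) : V :=
  BoundedContinuousFunction.ofNormedAddCommGroup
    (fun p : ℤ × ℝ => (wt p.1)⁻¹ * conv (cf β) (cf γ) p.1 p.2)
    (continuous_prod_of_discrete_left.2 fun m => (continuous_conv_cf β γ m).const_mul (wt m)⁻¹)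
    (convConst * ‖β‖ * ‖γ‖) (mulV_bound β γ)

lemma mulV_apply (β γ : V) (m : ℤ) (t : ℝ) :
    mulV β γ (m, t) = (wt m)⁻¹ * conv (cf β) (cf γ) m t := rfl

lemma cf_mulV (β γ : V) : cf (mulV β γ) = conv (cf β) (cf γ) := by
  funext m t
  have hw := (wt_pos m).ne'
  unfold cf
  rw [mulV_apply, mul_inv_cancel_left₀ hw]; rfl

lemma norm_mulV_le (β γ : V) : ‖mulV β γ‖ ≤ convConst * ‖β‖ * ‖γ‖ :=
  BoundedContinuousFunction.norm_ofNormedAddCommGroup_le _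
    (mul_nonneg (mul_nonneg convConst_nonneg (norm_nonneg _)) (norm_nonneg _)) (mulV_bound β γ)

lemma cf_injective : Function.Injective cf := fun β γ h => by
  ext ⟨m, t⟩
  have := congr_fun (congr_fun h m) t
  exact mul_left_cancel₀ (wt_pos m).ne' this

lemma cf_add (β γ : V) : cf (β + γ) = cf β + cf γ := by
  funext m t; simp [cf, mul_add]

lemma cf_sub (β γ : V) : cf (β - γ) = cf β - cf γ := by
  funext m t; simp [cf, mul_sub]

lemma cf_smul (a : ℝ) (β : V) : cf (a • β) = a • cf β := by
  funext m t; simp [cf]; ring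

/-- The product of `V` as a bounded bilinear map. -/
noncomputable def mulVL : V →L[ℝ] V →L[ℝ] V :=
  LinearMap.mkContinuous₂
    (LinearMap.mk₂ ℝ mulV
      (fun a b c => cf_injective <| by
        funext m t
        simp only [cf_mulV, cf_add, conv, Pi.add_apply, add_mul]
        exact (summable_cf_mul a c m t).tsum_add (summable_cf_mul b c m t))
      (fun x a b => cf_injective <| by
        funext m t
        simp only [cf_mulV, cf_smul, conv, Pi.smul_apply, smul_eq_mul, mul_assoc]
        exact tsum_mul_left)
      (fun a b c => cf_injective <| by
        funext m t
        simp only [cf_mulV, cf_add, conv, Pi.add_apply, mul_add]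
        exact (summable_cf_mul a b m t).tsum_add (summable_cf_mul a c m t))
      (fun x a b => cf_injective <| by
        funext m t
        simp only [cf_mulV, cf_smul, conv, Pi.smul_apply, smul_eq_mul, mul_left_comm]
        exact tsum_mul_left))
    convConst norm_mulV_le

lemma cf_mulVL (β γ : V) : cf (mulVL β γ) = conv (cf β) (cf γ) := cf_mulV β γ

/-- The normalized coefficient of index `m`. -/
noncomputable def sliceL (m : ℤ) : V →L[ℝ] BC :=
  LinearMap.mkContinuous
    { toFun := fun β => β.compContinuous ⟨fun t => (m, t), by fun_prop⟩
      map_add' := fun f g => by ext t; simp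
      map_smul' := fun c f => by ext t; simp }
    1 fun β => (BoundedContinuousFunction.norm_le (by positivity)).2 fun t => by
      simpa using β.norm_coe_le_norm (m, t)

lemma sliceL_apply (m : ℤ) (β : V) (t : ℝ) : sliceL m β t = β (m, t) := rfl

lemma norm_sliceL_le (m : ℤ) (β : V) : ‖sliceL m β‖ ≤ ‖β‖ :=
  (BoundedContinuousFunction.norm_le (by positivity)).2 fun t => β.norm_coe_le_norm (m, t)

/-- A family of operators acting coefficientwise, after a relabelling of the coefficients. -/
noncomputable def diagL (L : ℤ → BC →L[ℝ] BC) (σ : ℤ → ℤ) {C : ℝ} (hC : 0 ≤ C)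
    (hL : ∀ m h, ‖L m h‖ ≤ C * ‖h‖) : V →L[ℝ] V :=
  have hb : ∀ (β : V) (p : ℤ × ℝ), ‖L p.1 (sliceL (σ p.1) β) p.2‖ ≤ C * ‖β‖ := fun β p =>
    ((L p.1 (sliceL (σ p.1) β)).norm_coe_le_norm p.2).trans ((hL _ _).trans
      (mul_le_mul_of_nonneg_left (norm_sliceL_le _ _) hC))
  LinearMap.mkContinuous
    { toFun := fun β => BoundedContinuousFunction.ofNormedAddCommGroup
        (fun p : ℤ × ℝ => L p.1 (sliceL (σ p.1) β) p.2)
        (continuous_prod_of_discrete_left.2 fun m => (L m (sliceL (σ m) β)).continuous)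
        (C * ‖β‖) (hb β)
      map_add' := fun f g => by ext t; simp
      map_smul' := fun c f => by ext t; simp }
    C fun β => (BoundedContinuousFunction.norm_le (by positivity)).2 (hb β)

lemma diagL_apply (L : ℤ → BC →L[ℝ] BC) (σ : ℤ → ℤ) {C : ℝ} (hC : 0 ≤ C)
    (hL : ∀ m h, ‖L m h‖ ≤ C * ‖h‖) (β : V) (m : ℤ) (t : ℝ) :
    diagL L σ hC hL β (m, t) = L m (sliceL (σ m) β) t := rfl

lemma norm_diagL_le (L : ℤ → BC →L[ℝ] BC) (σ : ℤ → ℤ) {C : ℝ} (hC : 0 ≤ C)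
    (hL : ∀ m h, ‖L m h‖ ≤ C * ‖h‖) (β : V) : ‖diagL L σ hC hL β‖ ≤ C * ‖β‖ :=
  (BoundedContinuousFunction.norm_le (by positivity)).2 fun p =>
    ((L p.1 (sliceL (σ p.1) β)).norm_coe_le_norm p.2).trans ((hL _ _).trans
      (mul_le_mul_of_nonneg_left (norm_sliceL_le _ _) hC))

/-- The embedding of functions as multiples of the modes `±1`. -/
noncomputable def embL : BC →L[ℝ] V :=
  LinearMap.mkContinuous
    { toFun := fun h => BoundedContinuousFunction.ofNormedAddCommGroup
        (fun p : ℤ × ℝ => if p.1.natAbs = 1 then h p.2 else 0)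
        (continuous_prod_of_discrete_left.2 fun m => by
          by_cases hm : m.natAbs = 1
          · simpa [hm] using h.continuous
          · simpa [hm] using continuous_const)
        ‖h‖ (fun p => by
          split_ifs
          · exact h.norm_coe_le_norm _
          · simp)
      map_add' := fun f g => by
        ext p; simp only [BoundedContinuousFunction.coe_ofNormedAddCommGroup,
          BoundedContinuousFunction.coe_add, Pi.add_apply]; split_ifs <;> simp
      map_smul' := fun c f => by ext t; simp }
    1 fun h => (BoundedContinuousFunction.norm_le (by positivity)).2 fun p => by
      simp only [BoundedContinuousFunction.coe_ofNormedAddCommGroup, one_mul, LinearMap.coe_mk,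
        AddHom.coe_mk]
      split_ifs
      · exact h.norm_coe_le_norm _
      · simp

lemma embL_apply (h : BC) (m : ℤ) (t : ℝ) :
    embL h (m, t) = if m.natAbs = 1 then h t else 0 := rfl

lemma norm_embL_le (h : BC) : ‖embL h‖ ≤ ‖h‖ :=
  (BoundedContinuousFunction.norm_le (by positivity)).2 fun p => by
    rw [embL_apply]
    split_ifs
    · exact h.norm_coe_le_norm _
    · simp

lemma cf_embL (h : BC) (m : ℤ) (t : ℝ) :
    cf (embL h) m t = if m.natAbs = 1 then h t / 4 else 0 := by
  unfold cf
  rw [embL_apply]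
  split_ifs with hm
  · rcases Int.natAbs_eq_iff.1 hm with rfl | rfl
    · simp [wt_one]; ring
    · simp [wt_neg, wt_one]; ring
  · simp

lemma conv_cf_embL (h : BC) (d : Seq) (m : ℤ) (t : ℝ) :
    conv (cf (embL h)) d m t = h t / 4 * (d (m - 1) t + d (m + 1) t) := by
  unfold conv
  rw [tsum_eq_sum (s := {1, -1})]
  · simp [cf_embL]; ring
  · intro j hj
    have : ¬ j.natAbs = 1 := by
      simp at hj; omega
    simp [cf_embL, this]

/-- The nonlinearity `c - (16/3) c³ + (24/5) (1 + μ) c⁵` on sequences. -/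
noncomputable def nl (μ : ℝ) (c : Seq) : Seq :=
  c - (16 / 3 : ℝ) • conv c (conv c c)
    + (24 / 5 * (1 + μ)) • conv c (conv c (conv c (conv c c)))

/-- The nonlinearity on `V`. -/
noncomputable def nlV (x : V × ℝ) : V :=
  x.1 - (16 / 3 : ℝ) • mulVL x.1 (mulVL x.1 x.1)
    + (24 / 5 * (1 + x.2)) • mulVL x.1 (mulVL x.1 (mulVL x.1 (mulVL x.1 x.1)))

lemma cf_nlV (c : V) (μ : ℝ) : cf (nlV (c, μ)) = nl μ (cf c) := by
  simp only [nlV, nl, cf_add, cf_sub, cf_smul, cf_mulVL]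

lemma cf_mulVL_embL (b : BC) (x : V) (m : ℤ) (t : ℝ) :
    cf (mulVL (embL b) x) m t = b t / 4 * (cf x (m - 1) t + cf x (m + 1) t) := by
  rw [cf_mulVL, conv_cf_embL]

lemma sliceL_eq_cf (β : V) (t : ℝ) : sliceL 1 β t = 4 * cf β 1 t := by
  simp [sliceL_apply, cf, wt_one]

/-- The base point: the profile in the modes `±1`. -/
noncomputable def baseV : V := embL ((2 : ℝ) • frontBC)

lemma cf_baseV (m : ℤ) (t : ℝ) : cf baseV m t = if m.natAbs = 1 then front t / 2 else 0 := by
  rw [baseV, cf_embL]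
  simp only [BoundedContinuousFunction.coe_smul, frontBC_apply, smul_eq_mul]
  split_ifs <;> ring

lemma cf_mulVL_baseV (x : V) (m : ℤ) (t : ℝ) :
    cf (mulVL baseV x) m t = front t / 2 * (cf x (m - 1) t + cf x (m + 1) t) := by
  rw [baseV, cf_mulVL_embL]
  simp only [BoundedContinuousFunction.coe_smul, frontBC_apply, smul_eq_mul]
  ring

lemma exists_hasStrictFDerivAt_nlV :
    ∃ D : V × ℝ →L[ℝ] V, HasStrictFDerivAt nlV D (baseV, 0) ∧ ∀ (b : BC) (μ t : ℝ),
      sliceL 1 (D (embL b, μ)) t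
        = (1 - 12 * front t ^ 2 + 15 * front t ^ 4) * b t + μ * 6 * front t ^ 5 := by
  have hf : HasStrictFDerivAt (fun x : V × ℝ => x.1) (ContinuousLinearMap.fst ℝ V ℝ) (baseV, 0) :=
    hasStrictFDerivAt_fst
  have h2 := mulVL.hasStrictFDerivAt_of_bilinear hf hf
  have h3 := mulVL.hasStrictFDerivAt_of_bilinear hf h2
  have h4 := mulVL.hasStrictFDerivAt_of_bilinear hf h3
  have h5 := mulVL.hasStrictFDerivAt_of_bilinear hf h4
  have hs : HasStrictFDerivAt (fun x : V × ℝ => 24 / 5 * (1 + x.2))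
      ((24 / 5 : ℝ) • ContinuousLinearMap.snd ℝ V ℝ) (baseV, 0) :=
    (hasStrictFDerivAt_snd.const_add 1).const_mul (24 / 5)
  have h := (hf.sub (h3.const_smul (16 / 3 : ℝ))).add (hs.smul h5)
  refine ⟨_, h, fun b μ t => ?_⟩
  rw [sliceL_eq_cf]
  simp only [add_apply, sub_apply,
    smul_apply, ContinuousLinearMap.precompR_apply,
    ContinuousLinearMap.precompL_apply, ContinuousLinearMap.coe_fst',
    ContinuousLinearMap.smulRight_apply, ContinuousLinearMap.coe_snd', cf_add, cf_sub, cf_smul,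
    Pi.add_apply, Pi.sub_apply, Pi.smul_apply, smul_eq_mul, cf_mulVL_baseV, cf_mulVL_embL]
  norm_num [cf_add, cf_mulVL_baseV, cf_mulVL_embL, cf_baseV, cf_embL]
  ring

lemma sliceL_nlV_baseV (t : ℝ) : sliceL 1 (nlV (baseV, 0)) t
    = 2 * (front t - 4 * front t ^ 3 + 3 * front t ^ 5) := by
  rw [sliceL_eq_cf, nlV]
  simp only [cf_add, cf_sub, cf_smul,
    Pi.add_apply, Pi.sub_apply, Pi.smul_apply, smul_eq_mul, cf_mulVL_baseV]
  norm_num [cf_baseV]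
  ring

/-- A contraction on a small ball has a fixed point there. -/
lemma exists_fixedPoint_of_lipschitz {X : Type*} [NormedAddCommGroup X] [CompleteSpace X]
    (Φ : X → X) {r : ℝ} (hr : 0 ≤ r)
    (hL : ∀ x y, ‖x‖ ≤ r → ‖y‖ ≤ r → ‖Φ x - Φ y‖ ≤ 1 / 2 * ‖x - y‖) (h0 : ‖Φ 0‖ ≤ r / 2) :
    ∃ x, Φ x = x ∧ ‖x‖ ≤ r ∧ ‖x‖ ≤ 2 * ‖Φ 0‖ := by
  have hb : ∀ x, ‖x‖ ≤ r → ‖Φ x‖ ≤ ‖Φ 0‖ + 1 / 2 * ‖x‖ := fun x hx => by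
    have h1 := hL x 0 hx (by simpa using hr)
    have h2 : ‖Φ x‖ ≤ ‖Φ x - Φ 0‖ + ‖Φ 0‖ := by simpa using norm_add_le (Φ x - Φ 0) (Φ 0)
    rw [sub_zero] at h1; linarith
  have hm : MapsTo Φ (Metric.closedBall 0 r) (Metric.closedBall 0 r) := fun x hx => by
    rw [mem_closedBall_zero_iff] at hx ⊢
    linarith [hb x hx]
  have hc : ContractingWith (1 / 2) (hm.restrict Φ _ _) := by
    refine ⟨by norm_num [← NNReal.coe_lt_coe], LipschitzWith.of_dist_le_mul fun x y => ?_⟩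
    have := hL x y (mem_closedBall_zero_iff.1 x.2) (mem_closedBall_zero_iff.1 y.2)
    simpa [Subtype.dist_eq, dist_eq_norm] using this
  obtain ⟨x, hx, hfx, -⟩ := hc.exists_fixedPoint' Metric.isClosed_closedBall.isComplete hm
    (Metric.mem_closedBall_self hr) (edist_ne_top _ _)
  have hx' := mem_closedBall_zero_iff.1 hx
  refine ⟨x, hfx, hx', ?_⟩
  have := hb x hx'
  rw [hfx] at this
  linarith

lemma conv_neg {c d : Seq} (hc : ∀ m t, c (-m) t = c m t) (hd : ∀ m t, d (-m) t = d m t)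
    (m : ℤ) (t : ℝ) : conv c d (-m) t = conv c d m t := by
  unfold conv
  rw [← (Equiv.neg ℤ).tsum_eq]
  refine tsum_congr fun j => ?_
  simp only [Equiv.neg_apply]
  rw [hc, show -m - -j = -(m - j) by ring, hd]

lemma nl_neg {c : Seq} (hc : ∀ m t, c (-m) t = c m t) (μ : ℝ) (m : ℤ) (t : ℝ) :
    nl μ c (-m) t = nl μ c m t := by
  have h2 := conv_neg hc hc
  have h3 := conv_neg hc h2
  have h5 := conv_neg hc (conv_neg hc h3)
  simp only [nl, Pi.add_apply, Pi.sub_apply, Pi.smul_apply, hc, h3, h5]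

lemma conv_eq_zero_of_even {c d : Seq} (hc : ∀ m t, Even m → c m t = 0)
    (hd : ∀ m t, ¬ Even m → d m t = 0) (m : ℤ) (t : ℝ) (hm : Even m) : conv c d m t = 0 := by
  unfold conv
  refine (tsum_congr fun j => ?_).trans tsum_zero
  by_cases hj : Even j
  · rw [hc j t hj, zero_mul]
  · rw [hd (m - j) t (by rw [Int.even_sub]; tauto), mul_zero]

lemma conv_eq_zero_of_not_even {c d : Seq} (hc : ∀ m t, Even m → c m t = 0)
    (hd : ∀ m t, Even m → d m t = 0) (m : ℤ) (t : ℝ) (hm : ¬ Even m) : conv c d m t = 0 := by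
  unfold conv
  refine (tsum_congr fun j => ?_).trans tsum_zero
  by_cases hj : Even j
  · rw [hc j t hj, zero_mul]
  · rw [hd (m - j) t (by rw [Int.even_sub]; tauto), mul_zero]

lemma nl_eq_zero_of_even {c : Seq} (hc : ∀ m t, Even m → c m t = 0) (μ : ℝ) (m : ℤ) (t : ℝ)
    (hm : Even m) : nl μ c m t = 0 := by
  have h3 := conv_eq_zero_of_even hc (conv_eq_zero_of_not_even hc hc)
  have h5 := conv_eq_zero_of_even hc (conv_eq_zero_of_not_even hc h3)
  simp only [nl, Pi.add_apply, Pi.sub_apply, Pi.smul_apply, hc m t hm, h3 m t hm, h5 m t hm]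
  simp

/-- The coefficientwise inverse of `∂ₜ² - (m² - 1) / ε²` on the odd modes other than `±1`. -/
lemma exists_resolvent_family {ε : ℝ} (hε : 0 < ε) :
    ∃ R R1 : ℤ → BC →L[ℝ] BC, (∀ m h, ‖R m h‖ ≤ ε ^ 2 / 8 * ‖h‖) ∧
      (∀ m h, ‖R1 m h‖ ≤ ε * ‖h‖) ∧ (∀ m, R (-m) = R m) ∧
      (∀ m, Even m ∨ m.natAbs = 1 → R m = 0 ∧ R1 m = 0) ∧
      ∀ m, ¬ (Even m ∨ m.natAbs = 1) → ∀ h t, HasDerivAt (R m h) (R1 m h t) t ∧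
        HasDerivAt (R1 m h) (((m : ℝ) ^ 2 - 1) / ε ^ 2 * R m h t + h t) t := by
  have key : ∀ n : ℕ, ∃ R R1 : BC →L[ℝ] BC, (∀ h, ‖R h‖ ≤ ε ^ 2 / 8 * ‖h‖) ∧
      (∀ h, ‖R1 h‖ ≤ ε * ‖h‖) ∧ (Even n ∨ n = 1 → R = 0 ∧ R1 = 0) ∧
      (¬ (Even n ∨ n = 1) → ∀ h t, HasDerivAt (R h) (R1 h t) t ∧
        HasDerivAt (R1 h) (((n : ℝ) ^ 2 - 1) / ε ^ 2 * R h t + h t) t) := by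
    intro n
    by_cases hn : Even n ∨ n = 1
    · refine ⟨0, 0, fun h => ?_, fun h => ?_, fun _ => ⟨rfl, rfl⟩, fun h => absurd hn h⟩
      · simpa using by positivity
      · simpa using by positivity
    · have hn3 : 3 ≤ n := by
        by_contra hlt
        have : n = 0 ∨ n = 1 ∨ n = 2 := by omega
        rcases this with rfl | rfl | rfl <;> simp at hn
      have hn3' : (3 : ℝ) ≤ n := by exact_mod_cast hn3
      have h8 : 8 ≤ (n : ℝ) ^ 2 - 1 := by nlinarith
      have hs := Real.sq_sqrt (show 0 ≤ (n : ℝ) ^ 2 - 1 by linarith)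
      have hsp : 2 ≤ Real.sqrt ((n : ℝ) ^ 2 - 1) := Real.le_sqrt_of_sq_le (by linarith)
      have hκ : 0 < Real.sqrt ((n : ℝ) ^ 2 - 1) / ε := by positivity
      obtain ⟨R, R1, h1, h2, h3⟩ := exists_resolvent hκ
      refine ⟨R, R1, fun h => (h1 h).trans ?_, fun h => (h2 h).trans ?_, fun h => absurd h hn,
        fun _ h t => ?_⟩
      · rw [div_pow, hs, div_div_eq_mul_div, div_le_iff₀ (by linarith)]
        have : 0 ≤ ε ^ 2 * ‖h‖ := by positivity
        nlinarith
      · rw [div_div_eq_mul_div, div_le_iff₀ (by linarith)]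
        have : 0 ≤ ε * ‖h‖ := by positivity
        nlinarith
      · have := h3 h t
        rwa [div_pow, hs] at this
  choose R R1 h1 h2 h3 h4 using key
  have hev : ∀ m : ℤ, (Even m ∨ m.natAbs = 1) ↔ (Even m.natAbs ∨ m.natAbs = 1) := fun m => by
    rw [Int.natAbs_even]
  refine ⟨fun m => R m.natAbs, fun m => R1 m.natAbs, fun m => h1 _, fun m => h2 _,
    fun m => by simp, fun m hm => h3 _ ((hev m).1 hm), fun m hm h t => ?_⟩
  have := h4 _ (fun h => hm ((hev m).2 h)) h t
  rwa [Nat.cast_natAbs, Int.cast_abs, sq_abs] at this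

lemma exists_lipschitz_remainder {X Y : Type*} [NormedAddCommGroup X] [NormedSpace ℝ X]
    [NormedAddCommGroup Y] [NormedSpace ℝ Y] {f : X → Y} {D : X →L[ℝ] Y} {x : X}
    (h : HasStrictFDerivAt f D x) {η : ℝ} (hη : 0 < η) :
    ∃ ρ > 0, ∀ y z, ‖y‖ ≤ ρ → ‖z‖ ≤ ρ →
      ‖f (x + y) - f (x + z) - D (y - z)‖ ≤ η * ‖y - z‖ := by
  have h1 := (h.isLittleO.def hη)
  obtain ⟨ρ, hρ, hb⟩ := Metric.eventually_nhds_iff_ball.1 h1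
  refine ⟨ρ / 2, by positivity, fun y z hy hz => ?_⟩
  have h2 := hb (x + y, x + z) (by
    rw [mem_ball_iff_norm, Prod.mk_sub_mk, add_sub_cancel_left, add_sub_cancel_left, Prod.norm_mk]
    exact (max_le hy hz).trans_lt (by linarith))
  simpa using h2

/-- The derivative of `cf baseV`. -/
noncomputable def baseD : Seq := fun m t => if m.natAbs = 1 then frontD t / 2 else 0

set_option maxHeartbeats 2000000 in
/-- Coefficients of a solution of `ε² Ψ_tt + Ψ_yy + Ψ = ε² G(Ψ)` close to `A(t) cos y`. -/
theorem exists_coeffs : ∃ K ε₀ : ℝ, 0 < K ∧ 0 < ε₀ ∧ ∀ ε, 0 < ε → ε < ε₀ →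
    ∃ (μ : ℝ) (β : V) (c1 : Seq), |μ| ≤ K * ε ∧ (∀ m t, cf β (-m) t = cf β m t) ∧
      (∀ m t, Even m → cf β m t = 0) ∧ (∀ m t, HasDerivAt (cf β m) (c1 m t) t) ∧
      (∀ m t, HasDerivAt (c1 m) (((m : ℝ) ^ 2 - 1) / ε ^ 2 * cf β m t + nl μ (cf β) m t) t) ∧
      (∀ m t, |cf β m t - cf baseV m t| ≤ K * ε * wt m) ∧
      ∀ m t, |c1 m t - baseD m t| ≤ K * ε * wt m := by
  obtain ⟨S, S1, mm, hS⟩ := exists_front_solution (k := 6) (by norm_num)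
  obtain ⟨D, hD, hD1⟩ := exists_hasStrictFDerivAt_nlV
  set M : ℝ := ‖S‖ + ‖mm‖ + 1 with hM
  have hM1 : 1 ≤ M := by have := norm_nonneg S; have := norm_nonneg mm; linarith
  set η : ℝ := 1 / (8 * M) with hη
  have hη0 : 0 < η := by positivity
  have hηM : M * (2 * η) = 1 / 4 := by rw [hη]; field_simp; norm_num
  have hη1 : η ≤ 1 := by nlinarith
  obtain ⟨ρ, hρ, hQ⟩ := exists_lipschitz_remainder hD hη0
  set g0 := nlV (baseV, 0) with hg0
  set C := ‖D‖ with hC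
  have hC0 : 0 ≤ C := norm_nonneg D
  set K0 : ℝ := ‖g0‖ / 4 with hK0
  have hK00 : 0 ≤ K0 := by positivity
  refine ⟨2 * K0 + ‖S1‖ * K0 + ‖g0‖ + 2 * (1 + C) * ρ + 1,
    min (1 / (4 * M * (C + 1))) (ρ / (‖g0‖ + 1)), by positivity, by positivity, ?_⟩
  intro ε hε hεlt
  have he1 : ε * (4 * M * (C + 1)) ≤ 1 := by
    rw [← le_div_iff₀ (by positivity)]; exact hεlt.le.trans (min_le_left _ _)
  have he2 : ε * (‖g0‖ + 1) ≤ ρ := by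
    rw [← le_div_iff₀ (by positivity)]; exact hεlt.le.trans (min_le_right _ _)
  have he3 : ε * (C + 1) ≤ 1 / 4 := by
    have : 0 ≤ ε * (C + 1) := by positivity
    nlinarith
  have he4 : ε ≤ 1 / 4 := by nlinarith
  have he5 : M * (2 * η + C * ε) ≤ 1 / 2 := by
    have : M * (C * ε) ≤ 1 / 4 := by nlinarith [mul_pos hε (lt_of_lt_of_le one_pos hM1)]
    nlinarith
  obtain ⟨R, R1, hR, hR1, hRneg, hR0, hRd⟩ := exists_resolvent_family hε
  set 𝓡 : V →L[ℝ] V := diagL R (fun m => (m.natAbs : ℤ)) (by positivity) hR with h𝓡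
  have h𝓡n : ∀ h, ‖𝓡 h‖ ≤ ε ^ 2 / 8 * ‖h‖ := norm_diagL_le _ _ _ _
  set L : BC × V × ℝ →L[ℝ] V × ℝ :=
    ((embL ∘L ContinuousLinearMap.fst ℝ BC (V × ℝ)) + ε • ((ContinuousLinearMap.fst ℝ V ℝ) ∘L
      (ContinuousLinearMap.snd ℝ BC (V × ℝ)))).prod ((ContinuousLinearMap.snd ℝ V ℝ) ∘L
      (ContinuousLinearMap.snd ℝ BC (V × ℝ))) with hL
  have hLa : ∀ b u μ, L (b, u, μ) = (embL b + ε • u, μ) := fun b u μ => by simp [hL]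
  have hx1 : ∀ x : BC × V × ℝ, ‖x.1‖ ≤ ‖x‖ := fun x => norm_fst_le x
  have hx2 : ∀ x : BC × V × ℝ, ‖x.2.1‖ ≤ ‖x‖ := fun x =>
    (norm_fst_le x.2).trans (norm_snd_le x)
  have hx3 : ∀ x : BC × V × ℝ, ‖x.2.2‖ ≤ ‖x‖ := fun x =>
    (norm_snd_le x.2).trans (norm_snd_le x)
  have hLn : ∀ x, ‖L x‖ ≤ 2 * ‖x‖ := fun x => by
    have h0 : L x = (embL x.1 + ε • x.2.1, x.2.2) := hLa x.1 x.2.1 x.2.2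
    rw [h0, Prod.norm_mk]
    refine max_le ((norm_add_le _ _).trans ?_) ((hx3 x).trans (by linarith [norm_nonneg x]))
    rw [norm_smul, Real.norm_of_nonneg hε.le]
    have := (norm_embL_le x.1).trans (hx1 x)
    have := hx2 x
    nlinarith [norm_nonneg x, norm_nonneg x.2.1]
  set g : BC × V × ℝ → V := fun x => nlV ((baseV, 0) + L x) with hg
  set P : BC × V × ℝ →L[ℝ] V × ℝ := (ContinuousLinearMap.inl ℝ V ℝ) ∘L (ε •
    ((ContinuousLinearMap.fst ℝ V ℝ) ∘L (ContinuousLinearMap.snd ℝ BC (V × ℝ)))) with hP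
  have hPa : ∀ b u μ, P (b, u, μ) = (ε • u, 0) := fun b u μ => by simp [hP]
  have hPn : ∀ x, ‖P x‖ ≤ ε * ‖x‖ := fun x => by
    have h0 : P x = (ε • x.2.1, 0) := hPa x.1 x.2.1 x.2.2
    rw [h0, Prod.norm_mk, norm_smul, Real.norm_of_nonneg hε.le, norm_zero]
    exact max_le (mul_le_mul_of_nonneg_left (hx2 x) hε.le) (by positivity)
  set N : BC × V × ℝ → BC := fun x => sliceL 1 (g x - g0 - D (L x) + D (P x)) with hN
  have hgx : ∀ x y, ‖x‖ ≤ ρ / 2 → ‖y‖ ≤ ρ / 2 →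
      ‖g x - g y - D (L x - L y)‖ ≤ 2 * η * ‖x - y‖ := fun x y hx hy => by
    have h1 := hQ (L x) (L y) ((hLn x).trans (by linarith)) ((hLn y).trans (by linarith))
    refine h1.trans ?_
    rw [← map_sub]
    nlinarith [hLn (x - y)]
  have hgl : ∀ x y, ‖x‖ ≤ ρ / 2 → ‖y‖ ≤ ρ / 2 → ‖g x - g y‖ ≤ 2 * (1 + C) * ‖x - y‖ :=
    fun x y hx hy => by
      have h1 := hgx x y hx hy
      have h2 := (D.le_opNorm (L x - L y))
      rw [← map_sub L] at h1 h2
      have h3 : ‖D‖ * ‖L (x - y)‖ ≤ C * (2 * ‖x - y‖) :=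
        mul_le_mul_of_nonneg_left (hLn _) hC0
      have h4 := norm_add_le (g x - g y - D (L (x - y))) (D (L (x - y)))
      rw [sub_add_cancel] at h4
      nlinarith [norm_nonneg (x - y)]
  have hNl : ∀ x y, ‖x‖ ≤ ρ / 2 → ‖y‖ ≤ ρ / 2 → ‖N x - N y‖ ≤ (2 * η + C * ε) * ‖x - y‖ :=
    fun x y hx hy => by
      have h1 := hgx x y hx hy
      have h2 : N x - N y = sliceL 1 ((g x - g y - D (L x - L y)) + D (P (x - y))) := by
        simp only [hN, ← map_sub]
        congr 1
        simp only [map_sub]; abel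
      have h3 : ‖D (P (x - y))‖ ≤ C * (ε * ‖x - y‖) :=
        (D.le_opNorm _).trans (mul_le_mul_of_nonneg_left (hPn _) hC0)
      rw [h2]
      refine (norm_sliceL_le _ _).trans ((norm_add_le _ _).trans ?_)
      nlinarith
  set Φ : BC × V × ℝ → BC × V × ℝ := fun x => (S (N x), ε⁻¹ • 𝓡 (g x), mm (N x)) with hΦ
  have hΦl : ∀ x y, ‖x‖ ≤ ρ / 2 → ‖y‖ ≤ ρ / 2 → ‖Φ x - Φ y‖ ≤ 1 / 2 * ‖x - y‖ :=
    fun x y hx hy => by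
      have h1 := hNl x y hx hy
      have h2 := hgl x y hx hy
      have hd := norm_nonneg (x - y)
      have h6 : M * ‖N x - N y‖ ≤ 1 / 2 * ‖x - y‖ :=
        calc _ ≤ M * ((2 * η + C * ε) * ‖x - y‖) := by gcongr
          _ = (M * (2 * η + C * ε)) * ‖x - y‖ := by ring
          _ ≤ _ := by gcongr
      simp only [hΦ, Prod.mk_sub_mk, ← map_sub, Prod.norm_mk]
      refine max_le ?_ (max_le ?_ ?_)
      · refine (S.le_opNorm _).trans (le_trans ?_ h6)
        gcongr; rw [hM]; linarith [norm_nonneg mm]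
      · have h7 : ε⁻¹ • 𝓡 (g x) - ε⁻¹ • 𝓡 (g y) = ε⁻¹ • 𝓡 (g x - g y) := by
          rw [map_sub]; exact (smul_sub _ _ _).symm
        refine (congr_arg norm h7).trans_le ?_
        rw [norm_smul, Real.norm_of_nonneg (by positivity), inv_mul_le_iff₀ hε]
        refine (h𝓡n _).trans ?_
        calc ε ^ 2 / 8 * ‖g x - g y‖ ≤ ε ^ 2 / 8 * (2 * (1 + C) * ‖x - y‖) := by gcongr
          _ = ε * ((ε * (C + 1)) / 4 * ‖x - y‖) := by ring
          _ ≤ ε * (1 / 2 * ‖x - y‖) := mul_le_mul_of_nonneg_left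
            (mul_le_mul_of_nonneg_right (by linarith) hd) hε.le
      · refine (mm.le_opNorm _).trans (le_trans ?_ h6)
        gcongr; rw [hM]; linarith [norm_nonneg S]
  have hg00 : g 0 = g0 := by simp [hg, hg0]
  have hN0 : N 0 = 0 := by simp only [hN, hg00]; simp
  have hΦ0 : ‖Φ 0‖ ≤ ε / 8 * ‖g0‖ := by
    simp only [hΦ, hN0, map_zero, Prod.norm_mk, norm_zero, hg00]
    refine max_le (by positivity) (max_le ?_ (by positivity))
    rw [norm_smul, Real.norm_of_nonneg (by positivity), inv_mul_le_iff₀ hε]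
    refine (h𝓡n _).trans (le_of_eq ?_); ring
  obtain ⟨⟨b, u, μ⟩, hfix, hxr, hxn⟩ := exists_fixedPoint_of_lipschitz Φ (r := ρ / 2)
    (by positivity) hΦl (hΦ0.trans (by nlinarith))
  set x : BC × V × ℝ := (b, u, μ) with hx
  have hxK : ‖x‖ ≤ K0 * ε := hxn.trans (by rw [hK0]; nlinarith)
  have hb : S (N x) = b := congr_arg Prod.fst hfix
  have hu : ε⁻¹ • 𝓡 (g x) = u := congr_arg (fun p => p.2.1) hfix
  have hμ : mm (N x) = μ := congr_arg (fun p => p.2.2) hfix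
  have hu' : ε • u = 𝓡 (g x) := by rw [← hu, smul_inv_smul₀ hε.ne']
  set β : V := baseV + (embL b + ε • u) with hβ
  have hgβ : g x = nlV (β, μ) := by
    simp only [hg, hx, hLa, hβ]; simp
  have hcg : cf (g x) = nl μ (cf β) := by rw [hgβ, cf_nlV]
  have hua : ∀ m t, (ε • u) (m, t) = R m (sliceL m.natAbs (g x)) t := fun m t => by
    rw [hu', h𝓡, diagL_apply]
  have hcfβ : ∀ m t, cf β m t = cf baseV m t + (if m.natAbs = 1 then b t / 4 else 0)
      + wt m * R m (sliceL m.natAbs (g x)) t := fun m t => by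
    rw [hβ, cf_add, cf_add, Pi.add_apply, Pi.add_apply, Pi.add_apply, Pi.add_apply, cf_embL,
      ← hua, ← add_assoc]
    rfl
  have hev : ∀ m t, cf β (-m) t = cf β m t := fun m t => by
    rw [hcfβ, hcfβ, cf_baseV, cf_baseV, hRneg, Int.natAbs_neg, wt_neg]
  have hodd : ∀ m t, Even m → cf β m t = 0 := fun m t hm => by
    have h1 : ¬ m.natAbs = 1 := fun h => by rw [← Int.natAbs_even, h] at hm; simp at hm
    rw [hcfβ, cf_baseV, (hR0 m (Or.inl hm)).1]
    simp [h1]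
  have hNx : ∀ t, N x t = sliceL 1 (g x) t - sliceL 1 g0 t
      - ((1 - 12 * front t ^ 2 + 15 * front t ^ 4) * b t + μ * 6 * front t ^ 5) := fun t => by
    rw [← hD1]
    have h1 : D (L x) = D (embL b, μ) + D (P x) := by
      rw [← map_add, hx, hLa, hPa]; simp
    simp only [hN, h1, map_add, map_sub, BoundedContinuousFunction.coe_add,
      BoundedContinuousFunction.coe_sub, Pi.add_apply, Pi.sub_apply]
    ring
  set c1 : Seq := fun m t => baseD m t + (if m.natAbs = 1 then S1 (N x) t / 4 else 0)
      + wt m * R1 m (sliceL m.natAbs (g x)) t with hc1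
  have hgn : ‖g x‖ ≤ ‖g0‖ + 2 * (1 + C) * ρ := by
    have h1 := hgl x 0 hxr (by rw [norm_zero]; positivity)
    rw [hg00, sub_zero] at h1
    have h2 := norm_add_le (g x - g0) g0
    rw [sub_add_cancel] at h2
    have : 2 * (1 + C) * ‖x‖ ≤ 2 * (1 + C) * ρ := by gcongr; linarith
    linarith
  have hNn : ‖N x‖ ≤ K0 * ε := by
    have h1 := hNl x 0 hxr (by rw [norm_zero]; positivity)
    rw [hN0, sub_zero, sub_zero] at h1
    have : 2 * η + C * ε ≤ 1 := by nlinarith [mul_nonneg hC0 hε.le]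
    nlinarith [norm_nonneg x]
  have hp1 : 0 ≤ ‖S1‖ * K0 := by positivity
  have hp2 : 0 ≤ 2 * (1 + C) * ρ := by positivity
  have hp3 := norm_nonneg g0
  refine ⟨μ, β, c1, ?_, hev, hodd, fun m t => ?_, fun m t => ?_, fun m t => ?_, fun m t => ?_⟩
  · refine ((hx3 x).trans hxK).trans ?_
    gcongr; linarith
  · by_cases hm : m.natAbs = 1
    · have h1 : cf β m = fun t => front t / 2 + S (N x) t / 4 := by
        funext t; rw [hcfβ, cf_baseV, (hR0 m (Or.inr hm)).1, hb]; simp [hm]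
      rw [h1]
      refine (((hasDerivAt_front' t).div_const 2).add ((hS (N x) t).1.div_const 4)).congr_deriv ?_
      simp [hc1, baseD, hm, (hR0 m (Or.inr hm)).2]
    · have h1 : cf β m = fun t => wt m * R m (sliceL m.natAbs (g x)) t := by
        funext t; rw [hcfβ, cf_baseV]; simp [hm]
      rw [h1]
      by_cases hme : Even m
      · rw [(hR0 m (Or.inl hme)).1]
        simp [hc1, baseD, hm, (hR0 m (Or.inl hme)).2, hasDerivAt_const]
      · refine (((hRd m (by tauto) _ t).1).const_mul (wt m)).congr_deriv ?_
        simp [hc1, baseD, hm]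
  · rw [← hcg]
    by_cases hm : m.natAbs = 1
    · have h1 : c1 m = fun t => frontD t / 2 + S1 (N x) t / 4 := by
        funext t; simp [hc1, baseD, hm, (hR0 m (Or.inr hm)).2]
      rw [h1]
      refine (((hasDerivAt_frontD t).div_const 2).add ((hS (N x) t).2.div_const 4)).congr_deriv ?_
      have h2 : cf (g x) m t = sliceL 1 (g x) t / 4 := by
        rw [sliceL_eq_cf, hcg]
        rcases Int.natAbs_eq_iff.1 hm with rfl | rfl
        · norm_num
        · rw [nl_neg hev]; norm_num
      have h3 : (m : ℝ) ^ 2 = 1 := by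
        rcases Int.natAbs_eq_iff.1 hm with rfl | rfl <;> norm_num
      rw [h2, h3, hNx, hμ, hb, sliceL_nlV_baseV]
      unfold frontD; ring
    · have h1 : c1 m = fun t => wt m * R1 m (sliceL m.natAbs (g x)) t := by
        funext t; simp [hc1, baseD, hm]
      rw [h1]
      by_cases hme : Even m
      · rw [(hR0 m (Or.inl hme)).2, hodd m t hme, hcg, nl_eq_zero_of_even hodd μ m t hme]
        simp [hasDerivAt_const]
      · refine (((hRd m (by tauto) _ t).2).const_mul (wt m)).congr_deriv ?_
        have h2 : wt m * sliceL m.natAbs (g x) t = cf (g x) m t := by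
          rcases Int.natAbs_eq m with h | h
          · rw [← h]; rfl
          · have h4 : sliceL m.natAbs (g x) t = g x ((m.natAbs : ℤ), t) := rfl
            have h5 : wt m = wt m.natAbs := by
              conv_lhs => rw [h]
              exact wt_neg _
            rw [h4, h5]
            change cf (g x) _ t = _
            rw [hcg]
            conv_rhs => rw [h]
            rw [nl_neg hev]
        rw [mul_add, h2, hcfβ, cf_baseV]
        simp [hm]; ring
  · have h1 : cf β m t - cf baseV m t = wt m * (embL b + ε • u) (m, t) := by
      rw [hβ, cf_add]; simp [cf]
    have hw := wt_pos m
    rw [h1, abs_mul, abs_of_pos hw]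
    have h2 : ‖embL b + ε • u‖ ≤ 2 * K0 * ε := by
      refine (norm_add_le _ _).trans ?_
      rw [norm_smul, Real.norm_of_nonneg hε.le]
      have := (norm_embL_le b).trans ((hx1 x).trans hxK)
      have h3 : ‖u‖ ≤ K0 * ε := (hx2 x).trans hxK
      have : ε * ‖u‖ ≤ 1 * (K0 * ε) := by gcongr; linarith
      linarith
    calc _ ≤ wt m * (2 * K0 * ε) := by
          gcongr; exact (BoundedContinuousFunction.norm_coe_le_norm _ _).trans h2
      _ = 2 * K0 * ε * wt m := by ring
      _ ≤ _ := by gcongr; linarith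
  · have hw := wt_pos m
    by_cases hm : m.natAbs = 1
    · have h1 : c1 m t - baseD m t = wt m * S1 (N x) t := by
        have : wt m = 1 / 4 := by
          rcases Int.natAbs_eq_iff.1 hm with rfl | rfl
          · simp [wt_one]
          · simp [wt_neg, wt_one]
        rw [this]; simp [hc1, hm, (hR0 m (Or.inr hm)).2]; ring
      rw [h1, abs_mul, abs_of_pos hw]
      have h2 : |S1 (N x) t| ≤ ‖S1‖ * (K0 * ε) :=
        ((S1 (N x)).norm_coe_le_norm t).trans ((S1.le_opNorm _).trans (by gcongr))
      calc _ ≤ wt m * (‖S1‖ * (K0 * ε)) := by gcongr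
        _ = ‖S1‖ * K0 * ε * wt m := by ring
        _ ≤ _ := by gcongr; linarith
    · have h1 : c1 m t - baseD m t = wt m * R1 m (sliceL m.natAbs (g x)) t := by
        simp [hc1, hm]
      rw [h1, abs_mul, abs_of_pos hw]
      have h2 : |R1 m (sliceL m.natAbs (g x)) t| ≤ ε * (‖g0‖ + 2 * (1 + C) * ρ) :=
        ((R1 m (sliceL m.natAbs (g x))).norm_coe_le_norm t).trans ((hR1 _ _).trans
          (mul_le_mul_of_nonneg_left ((norm_sliceL_le _ _).trans hgn) hε.le))
      calc _ ≤ wt m * (ε * (‖g0‖ + 2 * (1 + C) * ρ)) := by gcongr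
        _ = (‖g0‖ + 2 * (1 + C) * ρ) * ε * wt m := by ring
        _ ≤ _ := mul_le_mul_of_nonneg_right (mul_le_mul_of_nonneg_right (by linarith) hε.le) hw.le

/-- Sequences of continuous functions with uniformly rapid decay. -/
def Rapid (c : Seq) : Prop :=
  (∀ m, Continuous (c m)) ∧ ∀ k : ℕ, ∃ C, 0 ≤ C ∧ ∀ m t, |c m t| * (1 + (m : ℝ) ^ 2) ^ k ≤ C

/-- Sequences with `n` derivatives, all of uniformly rapid decay. -/
def Good : ℕ → Seq → Prop
  | 0, c => Rapid c
  | n + 1, c => Rapid c ∧ ∃ c', (∀ m t, HasDerivAt (c m) (c' m t) t) ∧ Good n c'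

lemma Good.rapid {n : ℕ} {c : Seq} (h : Good n c) : Rapid c := by
  cases n with
  | zero => exact h
  | succ n => exact h.1

lemma Good.of_succ {n : ℕ} {c : Seq} (h : Good (n + 1) c) : Good n c := by
  induction n generalizing c with
  | zero => exact h.rapid
  | succ n ih => exact ⟨h.1, h.2.choose, h.2.choose_spec.1, ih h.2.choose_spec.2⟩

lemma Good.deriv {n : ℕ} {c c' : Seq} (h : Good (n + 1) c)
    (hc : ∀ m t, HasDerivAt (c m) (c' m t) t) : Good n c' := by
  obtain ⟨-, d, hd, hg⟩ := h
  have : c' = d := by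
    funext m t
    exact (hc m t).unique (hd m t)
  rwa [this]

lemma Rapid.add {c d : Seq} (hc : Rapid c) (hd : Rapid d) : Rapid (c + d) := by
  refine ⟨fun m => (hc.1 m).add (hd.1 m), fun k => ?_⟩
  obtain ⟨C, hC0, hC⟩ := hc.2 k
  obtain ⟨D, hD0, hD⟩ := hd.2 k
  refine ⟨C + D, by positivity, fun m t => ?_⟩
  have h1 : |(c + d) m t| ≤ |c m t| + |d m t| := abs_add_le _ _
  have h2 : 0 ≤ (1 + (m : ℝ) ^ 2) ^ k := by positivity
  nlinarith [hC m t, hD m t]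

/-- Multiplication of a sequence by a function of the mode. -/
def mulMode (a : ℤ → ℝ) (c : Seq) : Seq := fun m t => a m * c m t

lemma Rapid.mulMode {a : ℤ → ℝ} {c : Seq} {B : ℝ} (hc : Rapid c)
    (ha : ∀ m : ℤ, |a m| ≤ B * (1 + (m : ℝ) ^ 2)) : Rapid (mulMode a c) := by
  refine ⟨fun m => (hc.1 m).const_mul (a m), fun k => ?_⟩
  obtain ⟨C, hC0, hC⟩ := hc.2 (k + 1)
  have hB : 0 ≤ B := by simpa using (abs_nonneg _).trans (ha 0)
  refine ⟨B * C, by positivity, fun m t => ?_⟩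
  rw [EulerPlane.mulMode, abs_mul]
  calc |a m| * |c m t| * (1 + (m : ℝ) ^ 2) ^ k
      ≤ (B * (1 + (m : ℝ) ^ 2)) * |c m t| * (1 + (m : ℝ) ^ 2) ^ k := by gcongr; exact ha m
    _ = B * (|c m t| * (1 + (m : ℝ) ^ 2) ^ (k + 1)) := by ring
    _ ≤ B * C := by gcongr; exact hC m t

lemma Rapid.mul_le {c d : Seq} (hc : Rapid c) (hd : Rapid d) (k : ℕ) :
    ∃ C, 0 ≤ C ∧ ∀ m j t, |c j t * d (m - j) t| * (1 + (m : ℝ) ^ 2) ^ k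
      ≤ C * (1 / (1 + (j : ℝ) ^ 2)) := by
  obtain ⟨C, hC0, hC⟩ := hc.2 (k + 1)
  obtain ⟨D, hD0, hD⟩ := hd.2 k
  refine ⟨4 ^ k * C * D, by positivity, fun m j t => ?_⟩
  have h1 := one_add_sq_le m j
  have h2 := hC j t
  have h3 := hD (m - j) t
  rw [abs_mul]
  set x : ℝ := 1 + (j : ℝ) ^ 2 with hx
  set y : ℝ := 1 + ((m - j : ℤ) : ℝ) ^ 2 with hy
  have hx1 : 1 ≤ x := by rw [hx]; nlinarith [sq_nonneg (j : ℝ)]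
  have hy1 : 1 ≤ y := by rw [hy]; nlinarith [sq_nonneg ((m - j : ℤ) : ℝ)]
  have h4 : 1 + (m : ℝ) ^ 2 ≤ 4 * x * y := by nlinarith
  rw [mul_one_div, le_div_iff₀ (by positivity)]
  calc |c j t| * |d (m - j) t| * (1 + (m : ℝ) ^ 2) ^ k * x
      ≤ |c j t| * |d (m - j) t| * (4 * x * y) ^ k * x := by gcongr
    _ = 4 ^ k * (|c j t| * x ^ (k + 1)) * (|d (m - j) t| * y ^ k) := by
      rw [mul_pow, mul_pow]; ring
    _ ≤ 4 ^ k * C * D := by gcongr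

lemma Rapid.norm_mul_le {c d : Seq} (hc : Rapid c) (hd : Rapid d) :
    ∃ C, 0 ≤ C ∧ ∀ m j t, ‖c j t * d (m - j) t‖ ≤ C * (1 / (1 + (j : ℝ) ^ 2)) := by
  obtain ⟨C, hC0, hC⟩ := hc.mul_le hd 0
  exact ⟨C, hC0, fun m j t => by simpa using hC m j t⟩

lemma Rapid.summable_mul {c d : Seq} (hc : Rapid c) (hd : Rapid d) (m : ℤ) (t : ℝ) :
    Summable fun j => c j t * d (m - j) t := by
  obtain ⟨C, -, hC⟩ := hc.norm_mul_le hd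
  exact Summable.of_norm_bounded (summable_one_div_one_add_sq.mul_left C) fun j => hC m j t

lemma Rapid.conv {c d : Seq} (hc : Rapid c) (hd : Rapid d) : Rapid (conv c d) := by
  refine ⟨fun m => ?_, fun k => ?_⟩
  · obtain ⟨C, -, hC⟩ := hc.norm_mul_le hd
    exact continuous_tsum (fun j => (hc.1 j).mul (hd.1 (m - j)))
      (summable_one_div_one_add_sq.mul_left C) fun j t => hC m j t
  · obtain ⟨C, hC0, hC⟩ := hc.mul_le hd k
    refine ⟨C * ∑' j : ℤ, 1 / (1 + (j : ℝ) ^ 2), mul_nonneg hC0 (tsum_nonneg fun j => by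
      positivity), fun m t => ?_⟩
    have h1 : 0 ≤ (1 + (m : ℝ) ^ 2) ^ k := by positivity
    rw [← abs_of_nonneg h1, ← abs_mul, EulerPlane.conv, ← tsum_mul_right, ← tsum_mul_left]
    refine tsum_of_norm_bounded (f := fun j => c j t * d (m - j) t * (1 + (m : ℝ) ^ 2) ^ k)
      (summable_one_div_one_add_sq.mul_left C).hasSum fun j => ?_
    rw [norm_mul, Real.norm_of_nonneg h1]
    exact hC m j t

lemma Good.add {n : ℕ} {c d : Seq} (hc : Good n c) (hd : Good n d) : Good n (c + d) := by
  induction n generalizing c d with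
  | zero => exact Rapid.add hc hd
  | succ n ih =>
    obtain ⟨hc0, c', hc', hc1⟩ := hc
    obtain ⟨hd0, d', hd', hd1⟩ := hd
    exact ⟨hc0.add hd0, c' + d', fun m t => (hc' m t).add (hd' m t), ih hc1 hd1⟩

lemma Good.mulMode {n : ℕ} {a : ℤ → ℝ} {c : Seq} {B : ℝ} (hc : Good n c)
    (ha : ∀ m : ℤ, |a m| ≤ B * (1 + (m : ℝ) ^ 2)) : Good n (mulMode a c) := by
  induction n generalizing c with
  | zero => exact Rapid.mulMode hc ha
  | succ n ih =>
    obtain ⟨hc0, c', hc', hc1⟩ := hc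
    exact ⟨hc0.mulMode ha, EulerPlane.mulMode a c', fun m t => (hc' m t).const_mul (a m), ih hc1⟩

lemma Good.smul {n : ℕ} {c : Seq} (hc : Good n c) (r : ℝ) : Good n (r • c) := by
  have : r • c = EulerPlane.mulMode (fun _ => r) c := rfl
  rw [this]
  exact hc.mulMode (B := |r|) fun m => le_mul_of_one_le_right (abs_nonneg r)
    (by nlinarith [sq_nonneg (m : ℝ)])

lemma Good.sub {n : ℕ} {c d : Seq} (hc : Good n c) (hd : Good n d) : Good n (c - d) := by
  have := hc.add (hd.smul (-1))
  rwa [neg_one_smul, ← sub_eq_add_neg] at this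

lemma hasDerivAt_conv {c d c' d' : Seq} (hc : Rapid c) (hd : Rapid d) (hc1 : Rapid c')
    (hd1 : Rapid d') (hc' : ∀ m t, HasDerivAt (c m) (c' m t) t)
    (hd' : ∀ m t, HasDerivAt (d m) (d' m t) t) (m : ℤ) (t : ℝ) :
    HasDerivAt (conv c d m) ((conv c' d + conv c d') m t) t := by
  obtain ⟨C, hC0, hC⟩ := hc1.norm_mul_le hd
  obtain ⟨D, hD0, hD⟩ := hc.norm_mul_le hd1
  have h := hasDerivAt_tsum (u := fun j : ℤ => (C + D) * (1 / (1 + (j : ℝ) ^ 2)))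
    (summable_one_div_one_add_sq.mul_left (C + D))
    (fun j s => (hc' j s).mul (hd' (m - j) s))
    (fun j s => by
      refine (norm_add_le _ _).trans ?_
      rw [add_mul]
      exact add_le_add (hC m j s) (hD m j s)) (hc.summable_mul hd m 0) t
  refine h.congr_deriv ?_
  exact (hc1.summable_mul hd m t).tsum_add (hc.summable_mul hd1 m t)

lemma Good.conv {n : ℕ} {c d : Seq} (hc : Good n c) (hd : Good n d) : Good n (conv c d) := by
  induction n generalizing c d with
  | zero => exact Rapid.conv hc hd
  | succ n ih =>
    have hcn := hc.of_succ
    have hdn := hd.of_succ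
    obtain ⟨hc0, c', hc', hc1⟩ := hc
    obtain ⟨hd0, d', hd', hd1⟩ := hd
    exact ⟨hc0.conv hd0, EulerPlane.conv c' d + EulerPlane.conv c d',
      hasDerivAt_conv hc0 hd0 hc1.rapid hd1.rapid hc' hd', (ih hc1 hdn).add (ih hcn hd1)⟩

lemma Good.nl {n : ℕ} {c : Seq} (hc : Good n c) (μ : ℝ) : Good n (nl μ c) := by
  have h3 := hc.conv (hc.conv hc)
  exact (hc.sub (h3.smul _)).add ((hc.conv (hc.conv h3)).smul _)

/-- Exponential decay is rapid. -/
lemma rapid_of_abs_le_wt {c : Seq} {K : ℝ} (hc : ∀ m, Continuous (c m))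
    (h : ∀ m t, |c m t| ≤ K * wt m) : Rapid c := by
  refine ⟨hc, fun k => ?_⟩
  have hK : 0 ≤ K := by
    have := (abs_nonneg _).trans (h 0 0)
    exact nonneg_of_mul_nonneg_left this (wt_pos 0)
  have hb : ∃ C : ℝ, ∀ n : ℕ, ((n : ℝ) ^ (2 * k)) * (1 / 2) ^ n ≤ C := by
    have := tendsto_pow_const_mul_const_pow_of_abs_lt_one (2 * k)
      (r := (1 / 2 : ℝ)) (by rw [abs_of_pos] <;> norm_num)
    obtain ⟨C, hC⟩ := this.bddAbove_range
    exact ⟨C, fun n => hC ⟨n, rfl⟩⟩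
  obtain ⟨C, hC⟩ := hb
  refine ⟨K * (2 ^ k * (C + 1)), ?_, fun m t => ?_⟩
  · have := hC 1
    have : 0 ≤ C := le_trans (by positivity) this
    positivity
  have h1 : wt m * (1 + (m : ℝ) ^ 2) ^ k ≤ 2 ^ k * (C + 1) := by
    have h2 : wt m ≤ (1 / 2) ^ m.natAbs := by
      unfold wt
      exact div_le_self (by positivity) (by nlinarith [sq_nonneg (m : ℝ)])
    have h3 : (1 / 2 : ℝ) ^ m.natAbs ≤ 1 := pow_le_one₀ (by norm_num) (by norm_num)
    have h4 : (m : ℝ) ^ 2 = (m.natAbs : ℝ) ^ 2 := by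
      rw [Nat.cast_natAbs, Int.cast_abs, sq_abs]
    have h5 := hC m.natAbs
    have h6 : (1 + (m.natAbs : ℝ) ^ 2) ^ k ≤ 2 ^ k * ((m.natAbs : ℝ) ^ (2 * k) + 1) := by
      rcases Nat.eq_zero_or_pos m.natAbs with h0 | h0
      · rw [h0]; norm_num
        have : (1 : ℝ) ≤ 2 ^ k := one_le_pow₀ (by norm_num)
        have : (0 : ℝ) ≤ 0 ^ (2 * k) := by positivity
        nlinarith
      · have : (1 : ℝ) ≤ m.natAbs := by exact_mod_cast h0
        calc (1 + (m.natAbs : ℝ) ^ 2) ^ k ≤ (2 * (m.natAbs : ℝ) ^ 2) ^ k := by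
              gcongr; nlinarith
          _ = 2 ^ k * (m.natAbs : ℝ) ^ (2 * k) := by rw [mul_pow, pow_mul]
          _ ≤ _ := by gcongr; linarith
    rw [h4]
    calc wt m * (1 + (m.natAbs : ℝ) ^ 2) ^ k
        ≤ (1 / 2) ^ m.natAbs * (2 ^ k * ((m.natAbs : ℝ) ^ (2 * k) + 1)) := by gcongr
      _ = 2 ^ k * ((m.natAbs : ℝ) ^ (2 * k) * (1 / 2) ^ m.natAbs + (1 / 2) ^ m.natAbs) := by ring
      _ ≤ _ := by gcongr
  calc |c m t| * (1 + (m : ℝ) ^ 2) ^ k ≤ K * wt m * (1 + (m : ℝ) ^ 2) ^ k := by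
        gcongr; exact h m t
    _ = K * (wt m * (1 + (m : ℝ) ^ 2) ^ k) := by ring
    _ ≤ _ := by gcongr

/-- Rapidly decaying solutions of the coefficient equations are smooth. -/
lemma good_of_ode {c c1 : Seq} {μ ε : ℝ} (hc : Rapid c) (hc1 : Rapid c1)
    (h1 : ∀ m t, HasDerivAt (c m) (c1 m t) t)
    (h2 : ∀ m t, HasDerivAt (c1 m) (((m : ℝ) ^ 2 - 1) / ε ^ 2 * c m t + nl μ c m t) t)
    (n : ℕ) : Good n c := by
  have key : ∀ n, Good n c ∧ Good n c1 := by
    intro n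
    induction n with
    | zero => exact ⟨hc, hc1⟩
    | succ n ih =>
      refine ⟨⟨hc, c1, h1, ih.2⟩, hc1, mulMode (fun m => ((m : ℝ) ^ 2 - 1) / ε ^ 2) c + nl μ c,
        h2, (ih.1.mulMode (B := 1 / ε ^ 2) fun m => ?_).add (ih.1.nl μ)⟩
      rw [abs_div, abs_of_nonneg (sq_nonneg ε), div_eq_mul_one_div, mul_comm]
      gcongr
      exact (abs_sub _ _).trans (by rw [abs_of_nonneg (sq_nonneg _), abs_one, add_comm])
  exact (key n).1

/-- The Fourier series with coefficients `c` and phase `θ`. -/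
noncomputable def synth (θ : ℝ) (c : Seq) (t y : ℝ) : ℝ := ∑' m : ℤ, c m t * Real.cos (m * y + θ)

lemma Rapid.abs_le {c : Seq} (hc : Rapid c) :
    ∃ C, 0 ≤ C ∧ ∀ m t, |c m t| ≤ C * (1 / (1 + (m : ℝ) ^ 2)) := by
  obtain ⟨C, hC0, hC⟩ := hc.2 1
  refine ⟨C, hC0, fun m t => ?_⟩
  rw [mul_one_div, le_div_iff₀ (by positivity)]
  simpa using hC m t

lemma norm_mul_cos_le {a x B : ℝ} (h : |a| ≤ B) : ‖a * Real.cos x‖ ≤ B := by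
  rw [norm_mul, Real.norm_eq_abs, Real.norm_eq_abs]
  exact (mul_le_of_le_one_right (abs_nonneg _) (Real.abs_cos_le_one _)).trans h

lemma Rapid.summable_synth {c : Seq} (hc : Rapid c) (θ t y : ℝ) :
    Summable fun m : ℤ => c m t * Real.cos (m * y + θ) := by
  obtain ⟨C, -, hC⟩ := hc.abs_le
  exact Summable.of_norm_bounded (summable_one_div_one_add_sq.mul_left C)
    fun m => norm_mul_cos_le (hC m t)

lemma Rapid.exists_abs_synth_le {c : Seq} (hc : Rapid c) :
    ∃ C, ∀ θ t y, |synth θ c t y| ≤ C := by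
  obtain ⟨C, -, hC⟩ := hc.abs_le
  exact ⟨_, fun θ t y => tsum_of_norm_bounded (summable_one_div_one_add_sq.mul_left C).hasSum
    fun m => norm_mul_cos_le (hC m t)⟩

lemma Rapid.continuous_synth {c : Seq} (hc : Rapid c) (θ : ℝ) :
    Continuous fun p : ℝ × ℝ => synth θ c p.1 p.2 := by
  obtain ⟨C, -, hC⟩ := hc.abs_le
  refine continuous_tsum (fun m => ((hc.1 m).comp continuous_fst).mul (by fun_prop))
    (summable_one_div_one_add_sq.mul_left C) fun m p => norm_mul_cos_le (hC m p.1)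

lemma synth_add {c d : Seq} (hc : Rapid c) (hd : Rapid d) (θ t y : ℝ) :
    synth θ (c + d) t y = synth θ c t y + synth θ d t y := by
  unfold synth
  rw [← (hc.summable_synth θ t y).tsum_add (hd.summable_synth θ t y)]
  exact tsum_congr fun m => by rw [Pi.add_apply, Pi.add_apply, add_mul]

lemma synth_smul (r : ℝ) (c : Seq) (θ t y : ℝ) :
    synth θ (r • c) t y = r * synth θ c t y := by
  unfold synth
  rw [← tsum_mul_left]
  exact tsum_congr fun m => by rw [Pi.smul_apply, Pi.smul_apply, smul_eq_mul, mul_assoc]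

lemma synth_sub {c d : Seq} (hc : Rapid c) (hd : Rapid d) (θ t y : ℝ) :
    synth θ (c - d) t y = synth θ c t y - synth θ d t y := by
  unfold synth
  rw [← (hc.summable_synth θ t y).tsum_sub (hd.summable_synth θ t y)]
  exact tsum_congr fun m => by rw [Pi.sub_apply, Pi.sub_apply, sub_mul]

lemma abs_le_one_add_sq (m : ℤ) : |(m : ℝ)| ≤ 1 * (1 + (m : ℝ) ^ 2) := by
  rw [abs_le]
  constructor <;> nlinarith [sq_nonneg ((m : ℝ) - 1), sq_nonneg ((m : ℝ) + 1)]

/-- The coefficients of the `y`-derivative. -/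
noncomputable def dy (c : Seq) : Seq := mulMode (fun m => (m : ℝ)) c

lemma Rapid.dy {c : Seq} (hc : Rapid c) : Rapid (dy c) := hc.mulMode abs_le_one_add_sq

lemma Good.dy {n : ℕ} {c : Seq} (hc : Good n c) : Good n (dy c) := hc.mulMode abs_le_one_add_sq

open ContinuousLinearMap in
lemma hasFDerivAt_synth {c c' : Seq} (hc : Rapid c) (hc1 : Rapid c')
    (h : ∀ m t, HasDerivAt (c m) (c' m t) t) (θ : ℝ) (p : ℝ × ℝ) :
    HasFDerivAt (fun p : ℝ × ℝ => synth θ c p.1 p.2)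
      (synth θ c' p.1 p.2 • fst ℝ ℝ ℝ + synth (θ + Real.pi / 2) (dy c) p.1 p.2 • snd ℝ ℝ ℝ) p := by
  obtain ⟨C, hC0, hC⟩ := hc1.abs_le
  obtain ⟨D, hD0, hD⟩ := hc.dy.abs_le
  have h0 : ∀ (m : ℤ) (p : ℝ × ℝ), HasFDerivAt
      (fun p : ℝ × ℝ => c m p.1 * Real.cos (m * p.2 + θ))
      ((c' m p.1 * Real.cos (m * p.2 + θ)) • fst ℝ ℝ ℝ
        + (dy c m p.1 * Real.cos (m * p.2 + (θ + Real.pi / 2))) • snd ℝ ℝ ℝ) p := by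
    intro m p
    have h1 : HasFDerivAt (fun p : ℝ × ℝ => c m p.1) (c' m p.1 • fst ℝ ℝ ℝ) p :=
      (h m p.1).comp_hasFDerivAt p hasFDerivAt_fst
    have h2 : HasDerivAt (fun y : ℝ => Real.cos (m * y + θ)) (-Real.sin (m * p.2 + θ) * m) p.2 := by
      have := (((hasDerivAt_id p.2).const_mul (m : ℝ)).add_const θ).cos
      simpa using this
    have h3 : HasFDerivAt (fun p : ℝ × ℝ => Real.cos (m * p.2 + θ))
      ((-Real.sin (m * p.2 + θ) * m) • snd ℝ ℝ ℝ) p := h2.comp_hasFDerivAt p hasFDerivAt_snd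
    refine (h1.mul h3).congr_fderiv ?_
    rw [← add_assoc, Real.cos_add_pi_div_two]
    ext <;> simp [dy, mulMode] <;> ring
  have h1 := hasFDerivAt_tsum (u := fun m : ℤ => (C + D) * (1 / (1 + (m : ℝ) ^ 2)))
    (summable_one_div_one_add_sq.mul_left (C + D)) h0 (fun m p => by
      refine (norm_add_le _ _).trans ?_
      rw [norm_smul, norm_smul, add_mul]
      exact add_le_add
        ((mul_le_of_le_one_right (norm_nonneg _) (norm_fst_le ℝ ℝ ℝ)).trans
          (norm_mul_cos_le (hC m p.1)))
        ((mul_le_of_le_one_right (norm_nonneg _) (norm_snd_le ℝ ℝ ℝ)).trans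
          (norm_mul_cos_le (hD m p.1)))) (hc.summable_synth θ (0 : ℝ × ℝ).1 (0 : ℝ × ℝ).2) p
  refine h1.congr_fderiv ?_
  have s1 := hc1.summable_synth θ p.1 p.2
  have s2 := hc.dy.summable_synth (θ + Real.pi / 2) p.1 p.2
  rw [(s1.smul_const (fst ℝ ℝ ℝ)).tsum_add (s2.smul_const (snd ℝ ℝ ℝ)), s1.tsum_smul_const,
    s2.tsum_smul_const]
  rfl

lemma contDiff_synth {n : ℕ} {c : Seq} (hc : Good n c) (θ : ℝ) :
    ContDiff ℝ n fun p : ℝ × ℝ => synth θ c p.1 p.2 := by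
  induction n generalizing c θ with
  | zero => exact contDiff_zero.2 (hc.rapid.continuous_synth θ)
  | succ n ih =>
    have hcn := hc.of_succ
    obtain ⟨hc0, c', hc', hc1⟩ := hc
    have h := hasFDerivAt_synth hc0 hc1.rapid hc' θ
    rw [Nat.cast_succ, contDiff_succ_iff_fderiv]
    refine ⟨fun p => (h p).differentiableAt, by simp, ?_⟩
    rw [show fderiv ℝ (fun p : ℝ × ℝ => synth θ c p.1 p.2) = _ from funext fun p => (h p).fderiv]
    exact ((ih hc1 θ).smul contDiff_const).add ((ih hcn.dy _).smul contDiff_const)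

lemma hasDerivAt_synth_fst {c c' : Seq} (hc : Rapid c) (hc1 : Rapid c')
    (h : ∀ m t, HasDerivAt (c m) (c' m t) t) (θ t y : ℝ) :
    HasDerivAt (fun t => synth θ c t y) (synth θ c' t y) t := by
  have h1 := (hasFDerivAt_synth hc hc1 h θ (t, y)).comp_hasDerivAt t
    ((hasDerivAt_id t).prodMk (hasDerivAt_const t y))
  refine h1.congr_deriv ?_
  simp

lemma hasDerivAt_synth_snd {c c' : Seq} (hc : Rapid c) (hc1 : Rapid c')
    (h : ∀ m t, HasDerivAt (c m) (c' m t) t) (θ t y : ℝ) :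
    HasDerivAt (fun y => synth θ c t y) (synth (θ + Real.pi / 2) (dy c) t y) y := by
  have h1 := (hasFDerivAt_synth hc hc1 h θ (t, y)).comp_hasDerivAt y
    ((hasDerivAt_const y t).prodMk (hasDerivAt_id y))
  refine h1.congr_deriv ?_
  simp

lemma tsum_tsum_mul_sub {a b : ℤ → ℝ} (ha : Summable fun j => ‖a j‖)
    (hb : Summable fun j => ‖b j‖) : (∀ m, Summable fun j => a j * b (m - j)) ∧
      Summable (fun m => ∑' j, a j * b (m - j)) ∧
      ∑' m, ∑' j, a j * b (m - j) = (∑' j, a j) * ∑' j, b j := by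
  have h := summable_mul_of_summable_norm ha hb
  let e : ℤ × ℤ ≃ ℤ × ℤ :=
    { toFun := fun p => (p.2, p.1 - p.2)
      invFun := fun p => (p.1 + p.2, p.1)
      left_inv := fun p => by simp
      right_inv := fun p => by simp }
  have he : Summable fun p : ℤ × ℤ => a p.2 * b (p.1 - p.2) := e.summable_iff.2 h
  refine ⟨fun m => he.prod_factor m, he.prod, ?_⟩
  rw [tsum_mul_tsum_of_summable_norm ha hb, ← he.tsum_prod]
  exact e.tsum_eq fun p : ℤ × ℤ => a p.1 * b p.2

lemma tsum_eq_zero_of_odd {a : ℤ → ℝ} (h : ∀ m, a (-m) = -a m) : ∑' m, a m = 0 := by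
  have h1 := (Equiv.neg ℤ).tsum_eq a
  simp only [Equiv.neg_apply, h, tsum_neg] at h1
  linarith

/-- The Cauchy product of even sequences corresponds to the product of their Fourier series. -/
lemma synth_conv {c d : Seq} (hc : Rapid c) (hd : Rapid d) (hce : ∀ m t, c (-m) t = c m t)
    (t y : ℝ) : synth 0 (conv c d) t y = synth 0 c t y * synth 0 d t y := by
  have hsin : ∀ (a x : ℝ), ‖a * Real.sin x‖ ≤ |a| := fun a x => by
    rw [norm_mul, Real.norm_eq_abs, Real.norm_eq_abs]
    exact mul_le_of_le_one_right (abs_nonneg _) (Real.abs_sin_le_one _)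
  have hC : ∀ {c : Seq}, Rapid c → Summable (fun m : ℤ => ‖c m t * Real.cos (m * y)‖) ∧
      Summable (fun m : ℤ => ‖c m t * Real.sin (m * y)‖) := fun {c} hc => by
    obtain ⟨C, -, hC⟩ := hc.abs_le
    have hs := summable_one_div_one_add_sq.mul_left C
    exact ⟨Summable.of_nonneg_of_le (fun _ => norm_nonneg _)
      (fun m => norm_mul_cos_le (hC m t)) hs, Summable.of_nonneg_of_le (fun _ => norm_nonneg _)
      (fun m => (hsin _ _).trans (hC m t)) hs⟩
  obtain ⟨a1, a2, a3⟩ := tsum_tsum_mul_sub (hC hc).1 (hC hd).1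
  obtain ⟨b1, b2, b3⟩ := tsum_tsum_mul_sub (hC hc).2 (hC hd).2
  have hz : ∑' m : ℤ, c m t * Real.sin (m * y) = 0 := tsum_eq_zero_of_odd fun m => by
    rw [hce]; push_cast; rw [neg_mul, Real.sin_neg, mul_neg]
  rw [hz, zero_mul] at b3
  simp only [synth, add_zero]
  rw [← a3]
  refine Eq.trans ?_ ((a2.tsum_sub b2).trans (by rw [b3, sub_zero]))
  refine tsum_congr fun m => ?_
  rw [← (a1 m).tsum_sub (b1 m), conv, ← tsum_mul_right]
  refine tsum_congr fun j => ?_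
  rw [show (m : ℝ) * y = j * y + ((m - j : ℤ) : ℝ) * y by push_cast; ring, Real.cos_add]
  ring

lemma synth_nl {c : Seq} (hc : Rapid c) (hce : ∀ m t, c (-m) t = c m t) (μ t y : ℝ) :
    synth 0 (nl μ c) t y = synth 0 c t y - 16 / 3 * synth 0 c t y ^ 3
      + 24 / 5 * (1 + μ) * synth 0 c t y ^ 5 := by
  have h2 := hc.conv hc
  have h3 := hc.conv h2
  have h4 := hc.conv h3
  have h5 := hc.conv h4
  have g3 := Good.smul (n := 0) h3 (16 / 3)
  have g5 := Good.smul (n := 0) h5 (24 / 5 * (1 + μ))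
  have gs : Rapid (c - (16 / 3 : ℝ) • conv c (conv c c)) := Good.sub (n := 0) hc g3
  rw [nl, synth_add gs g5, synth_sub hc g3, synth_smul, synth_smul, synth_conv hc h4 hce,
    synth_conv hc h3 hce, synth_conv hc h2 hce, synth_conv hc hc hce]
  ring

lemma synth_add_pi {c : Seq} (hodd : ∀ m t, Even m → c m t = 0) (θ t y : ℝ) :
    synth θ c t (y + Real.pi) = -synth θ c t y := by
  unfold synth
  rw [← tsum_neg]
  refine tsum_congr fun m => ?_
  by_cases hm : Even m
  · rw [hodd m t hm]; simp
  · rw [show (m : ℝ) * (y + Real.pi) + θ = (m * y + θ) + m * Real.pi by ring,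
      Real.cos_add_int_mul_pi, Odd.neg_one_zpow (Int.not_even_iff_odd.1 hm)]
    ring

lemma synth_neg (c : Seq) (t y : ℝ) :
    synth 0 c t (-y) = synth 0 c t y := by
  unfold synth
  refine tsum_congr fun m => ?_
  rw [add_zero, add_zero, mul_neg, Real.cos_neg]

lemma abs_cos_odd_mul_le (m : ℤ) (hm : ¬ Even m) (y : ℝ) :
    |Real.cos (m * y)| ≤ m.natAbs * |Real.cos y| := by
  have key : ∀ n : ℕ, |Real.cos ((2 * n + 1 : ℕ) * y)| ≤ (2 * n + 1 : ℕ) * |Real.cos y| := by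
    intro n
    induction n with
    | zero => simp
    | succ n ih =>
      have h : Real.cos ((2 * (n + 1) + 1 : ℕ) * y)
          = 2 * Real.cos y * Real.cos ((2 * n + 2 : ℕ) * y) - Real.cos ((2 * n + 1 : ℕ) * y) := by
        rw [show ((2 * (n + 1) + 1 : ℕ) : ℝ) * y = (2 * n + 2 : ℕ) * y + y by push_cast; ring,
          show ((2 * n + 1 : ℕ) : ℝ) * y = (2 * n + 2 : ℕ) * y - y by push_cast; ring,
          Real.cos_add, Real.cos_sub]
        ring
      have h1 : |2 * Real.cos y * Real.cos ((2 * n + 2 : ℕ) * y)| ≤ 2 * |Real.cos y| := by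
        rw [abs_mul, abs_mul, abs_two]
        exact mul_le_of_le_one_right (by positivity) (Real.abs_cos_le_one _)
      rw [h]
      refine (abs_sub _ _).trans ((add_le_add h1 ih).trans (le_of_eq ?_))
      push_cast; ring
  have h1 : Real.cos (m * y) = Real.cos (m.natAbs * y) := by
    rw [Nat.cast_natAbs, Int.cast_abs]
    rcases abs_choice (m : ℝ) with h | h <;> rw [h]
    rw [neg_mul, Real.cos_neg]
  obtain ⟨n, hn⟩ : Odd m.natAbs := Int.natAbs_odd.2 (Int.not_even_iff_odd.1 hm)
  rw [h1, hn]
  exact key n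

/-- The sum of the dominating series. -/
noncomputable def sumConst : ℝ := ∑' m : ℤ, 1 / (1 + (m : ℝ) ^ 2)

lemma abs_synth_sub_le {d : Seq} (hd : Rapid d) (hodd : ∀ m t, Even m → d m t = 0) {a E t : ℝ}
    (h : ∀ m, |d m t - (if m.natAbs = 1 then a / 2 else 0)| ≤ E * wt m) (y : ℝ) :
    |synth 0 d t y - a * Real.cos y| ≤ E * sumConst * |Real.cos y| := by
  have hE : 0 ≤ E := nonneg_of_mul_nonneg_left ((abs_nonneg _).trans (h 0)) (wt_pos 0)
  have hb : ∑' m : ℤ, (if m.natAbs = 1 then a / 2 else 0) * Real.cos (m * y + 0)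
      = a * Real.cos y := by
    rw [tsum_eq_sum (s := {1, -1}) fun m hm => ?_]
    · rw [Finset.sum_pair (by norm_num)]
      simp; ring
    · have : m.natAbs ≠ 1 := fun h1 => hm (by
        rcases Int.natAbs_eq_iff.1 h1 with rfl | rfl <;> simp)
      rw [if_neg this, zero_mul]
  have hbs : Summable fun m : ℤ => (if m.natAbs = 1 then a / 2 else 0) * Real.cos (m * y + 0) :=
    summable_of_ne_finset_zero (s := {1, -1}) fun m hm => by
      have : m.natAbs ≠ 1 := fun h1 => hm (by
        rcases Int.natAbs_eq_iff.1 h1 with rfl | rfl <;> simp)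
      rw [if_neg this, zero_mul]
  rw [← hb, synth, ← (hd.summable_synth 0 t y).tsum_sub hbs]
  have : E * sumConst * |Real.cos y| = ∑' m : ℤ, (E * |Real.cos y|) * (1 / (1 + (m : ℝ) ^ 2)) := by
    rw [tsum_mul_left, sumConst]; ring
  rw [this]
  rw [← Real.norm_eq_abs]
  refine tsum_of_norm_bounded (summable_one_div_one_add_sq.mul_left _).hasSum fun m => ?_
  rw [← sub_mul, add_zero, norm_mul, Real.norm_eq_abs, Real.norm_eq_abs]
  by_cases hm : Even m
  · have : m.natAbs ≠ 1 := fun h1 => by rw [← Int.natAbs_even, h1] at hm; simp at hm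
    rw [hodd m t hm, if_neg this]
    simp only [sub_zero, abs_zero, zero_mul]
    positivity
  · have h1 := abs_cos_odd_mul_le m hm y
    have h2 : (m.natAbs : ℝ) * (1 / 2) ^ m.natAbs ≤ 1 := by
      rw [one_div_pow, mul_one_div, div_le_one (by positivity)]
      exact_mod_cast Nat.lt_two_pow_self.le
    calc _ ≤ (E * wt m) * (m.natAbs * |Real.cos y|) :=
          mul_le_mul (h m) h1 (abs_nonneg _) (mul_nonneg hE (wt_pos m).le)
      _ = (E * |Real.cos y|) * ((m.natAbs * (1 / 2) ^ m.natAbs) * (1 / (1 + (m : ℝ) ^ 2))) := by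
          unfold wt; ring
      _ ≤ (E * |Real.cos y|) * (1 * (1 / (1 + (m : ℝ) ^ 2))) := by gcongr
      _ = _ := by rw [one_mul]

lemma synth_yy (c : Seq) (t y : ℝ) :
    synth (0 + Real.pi / 2 + Real.pi / 2) (dy (dy c)) t y
      = -synth 0 (mulMode (fun m => (m : ℝ) ^ 2) c) t y := by
  unfold synth
  rw [← tsum_neg]
  refine tsum_congr fun m => ?_
  rw [show (m : ℝ) * y + (0 + Real.pi / 2 + Real.pi / 2) = (m * y + 0) + Real.pi by ring,
    Real.cos_add_pi]
  simp only [dy, mulMode]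
  ring

/-- The equation for the profile. -/
lemma synth_eq {c c2 : Seq} {μ ε : ℝ} (hε : ε ≠ 0) (hc : Rapid c)
    (hce : ∀ m t, c (-m) t = c m t)
    (h2 : ∀ m t, c2 m t = ((m : ℝ) ^ 2 - 1) / ε ^ 2 * c m t + nl μ c m t) (t y : ℝ) :
    ε ^ 2 * synth 0 c2 t y + synth (0 + Real.pi / 2 + Real.pi / 2) (dy (dy c)) t y
      + synth 0 c t y = ε ^ 2 * (synth 0 c t y - 16 / 3 * synth 0 c t y ^ 3
      + 24 / 5 * (1 + μ) * synth 0 c t y ^ 5) := by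
  have hn : Rapid (nl μ c) := Good.nl (n := 0) hc μ
  have hm : Rapid (mulMode (fun m => (m : ℝ) ^ 2) c) :=
    hc.mulMode (B := 1) fun m => by rw [abs_of_nonneg (sq_nonneg _)]; linarith
  have e : ε ^ 2 • c2 = mulMode (fun m => (m : ℝ) ^ 2) c - c + ε ^ 2 • nl μ c := by
    funext m t
    simp only [Pi.smul_apply, Pi.add_apply, Pi.sub_apply, mulMode, h2, smul_eq_mul]
    field_simp
  rw [← synth_nl hc hce, synth_yy, ← synth_smul, ← synth_smul, e,
    synth_add (Good.sub (n := 0) hm hc) (Good.smul (n := 0) hn _), synth_sub hm hc]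
  ring

/-- The linearized equation for the `t`-derivative of the profile. -/
lemma synth_eq_deriv {c c1 c2 c3 : Seq} {μ ε : ℝ} (hε : ε ≠ 0) (hc : Rapid c) (hc1 : Rapid c1)
    (hc2 : Rapid c2) (hc3 : Rapid c3) (hce : ∀ m t, c (-m) t = c m t)
    (h1 : ∀ m t, HasDerivAt (c m) (c1 m t) t)
    (h3 : ∀ m t, HasDerivAt (c2 m) (c3 m t) t)
    (h2 : ∀ m t, c2 m t = ((m : ℝ) ^ 2 - 1) / ε ^ 2 * c m t + nl μ c m t) (t y : ℝ) :
    ε ^ 2 * synth 0 c3 t y + synth (0 + Real.pi / 2 + Real.pi / 2) (dy (dy c1)) t y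
      + synth 0 c1 t y = ε ^ 2 * ((1 - 16 * synth 0 c t y ^ 2
      + 24 * (1 + μ) * synth 0 c t y ^ 4) * synth 0 c1 t y) := by
  have a0 := hasDerivAt_synth_fst hc hc1 h1 0 t y
  have a2 := hasDerivAt_synth_fst hc2 hc3 h3 0 t y
  have ay := hasDerivAt_synth_fst hc.dy.dy hc1.dy.dy
    (fun m t => ((h1 m t).const_mul (m : ℝ)).const_mul (m : ℝ)) (0 + Real.pi / 2 + Real.pi / 2) t y
  have l := ((a2.const_mul (ε ^ 2)).add ay).add a0
  have r := ((a0.sub ((a0.pow 3).const_mul (16 / 3))).add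
    ((a0.pow 5).const_mul (24 / 5 * (1 + μ)))).const_mul (ε ^ 2)
  have r' := r.congr_of_eventuallyEq (f₁ := _) (Eventually.of_forall
    fun s => synth_eq hε hc hce h2 s y)
  refine (l.unique r').trans ?_
  simp only [Nat.cast_ofNat, Nat.reduceSub]
  ring

lemma deriv_deriv_nonneg_of_isLocalMin {f f1 : ℝ → ℝ} {f2 x : ℝ} (h1 : ∀ y, HasDerivAt f (f1 y) y)
    (h2 : HasDerivAt f1 f2 x) (hmin : IsLocalMin f x) : 0 ≤ f2 := by
  by_contra! hneg
  have e1 : deriv f = f1 := funext fun y => (h1 y).deriv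
  have e0 : f1 x = 0 := by rw [← e1]; exact hmin.deriv_eq_zero
  have hmax : IsLocalMax f x := isLocalMax_of_deriv_deriv_neg (by rwa [e1, h2.deriv])
    (by rw [e1, e0]) (h1 x).continuousAt
  have hc : f =ᶠ[𝓝 x] fun _ => f x := by
    filter_upwards [hmin, hmax] with y h3 h4 using le_antisymm h4 h3
  have hd : f1 =ᶠ[𝓝 x] fun _ => 0 := by
    rw [← e1]
    filter_upwards [hc.eventuallyEq_nhds] with y hy
    rw [hy.deriv_eq, deriv_const]
  have := h2.unique ((hasDerivAt_const x (0 : ℝ)).congr_of_eventuallyEq hd)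
  linarith

/-- A function with its first two pure partial derivatives. -/
structure Deriv2 (u ut utt uy uyy : ℝ → ℝ → ℝ) : Prop where
  cont : Continuous fun p : ℝ × ℝ => u p.1 p.2
  t1 : ∀ t y, HasDerivAt (fun t => u t y) (ut t y) t
  t2 : ∀ t y, HasDerivAt (fun t => ut t y) (utt t y) t
  y1 : ∀ t y, HasDerivAt (fun y => u t y) (uy t y) y
  y2 : ∀ t y, HasDerivAt (fun y => uy t y) (uyy t y) y

/-- A maximum principle in a half-strip, in the presence of a positive strict supersolution. -/
lemma nonneg_of_supersolution {u ut utt uy uyy q : ℝ → ℝ → ℝ} {H H1 H2 : ℝ → ℝ} {δ σ T B l : ℝ}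
    (hu : Deriv2 u ut utt uy uyy) (hσ : 0 < σ) (hδ : 0 ≤ δ) (hl : 0 ≤ l)
    (hB : ∀ t y, T ≤ t → |u t y| ≤ B) (hT : ∀ y, |y| ≤ l → 0 ≤ u T y)
    (hl1 : ∀ t, T ≤ t → 0 ≤ u t l) (hl2 : ∀ t, T ≤ t → 0 ≤ u t (-l))
    (hH1 : ∀ y, HasDerivAt H (H1 y) y) (hH2 : ∀ y, HasDerivAt H1 (H2 y) y)
    (hH : ∀ y, |y| ≤ l → 0 < H y)
    (hle : ∀ t y, T ≤ t → |y| ≤ l → δ * utt t y + uyy t y + (1 + q t y) * u t y ≤ 0)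
    (hlt : ∀ t y, T ≤ t → |y| ≤ l → δ * (σ ^ 2 * H y) + H2 y + (1 + q t y) * H y < 0)
    {t y : ℝ} (ht : T ≤ t) (hy : |y| ≤ l) : 0 ≤ u t y := by
  by_contra! hneg
  have hHc : Continuous H := continuous_iff_continuousAt.2 fun y => (hH1 y).continuousAt
  obtain ⟨ym, hym, hmin⟩ := (isCompact_Icc (a := -l) (b := l)).exists_isMinOn
    ⟨0, by simpa using hl⟩ hHc.continuousOn
  have hh0 : 0 < H ym := hH ym (abs_le.2 hym)
  have hHge : ∀ y, |y| ≤ l → H ym ≤ H y := fun y hy => hmin (abs_le.1 hy)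
  set w : ℝ × ℝ → ℝ := fun p => u p.1 p.2 * Real.exp (-(σ * p.1)) / H p.2 with hw
  have hwneg : w (t, y) < 0 := div_neg_of_neg_of_pos (mul_neg_of_neg_of_pos hneg (Real.exp_pos _))
    (hH y hy)
  have hlim : Tendsto (fun s : ℝ => B * Real.exp (-(σ * s)) / H ym) atTop (𝓝 0) := by
    have h1 : Tendsto (fun s : ℝ => σ * s) atTop atTop := tendsto_id.const_mul_atTop hσ
    have h2 := ((Real.tendsto_exp_neg_atTop_nhds_zero.comp h1).const_mul B).div_const (H ym)
    simpa using h2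
  obtain ⟨T1, hT1, hT1t⟩ := ((hlim.eventually (gt_mem_nhds (neg_pos.2 hwneg))).and
    (eventually_gt_atTop t)).exists
  have hwT1 : ∀ y', |y'| ≤ l → w (t, y) < w (T1, y') := fun y' hy' => by
    have h1 : -(B * Real.exp (-(σ * T1)) / H ym) ≤ w (T1, y') := by
      rw [hw, ← neg_div, ← neg_mul]
      have h2 := hB T1 y' (ht.trans hT1t.le)
      have hB0 : 0 ≤ B := (abs_nonneg _).trans h2
      have h3 : -B * Real.exp (-(σ * T1)) / H ym ≤ -B * Real.exp (-(σ * T1)) / H y' := by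
        rw [neg_mul, neg_div, neg_div, neg_le_neg_iff]
        exact div_le_div_of_nonneg_left (by positivity) hh0 (hHge y' hy')
      refine h3.trans (div_le_div_of_nonneg_right ?_ (hH y' hy').le)
      exact mul_le_mul_of_nonneg_right (abs_le.1 h2).1 (Real.exp_pos _).le
    linarith
  have hwc : ContinuousOn w (Icc T T1 ×ˢ Icc (-l) l) := by
    refine ContinuousOn.div (hu.cont.mul (by fun_prop)).continuousOn
      (hHc.comp continuous_snd).continuousOn fun p hp => (hH p.2 (abs_le.2 hp.2)).ne'
  obtain ⟨⟨t0, y0⟩, ⟨ht0, hy0⟩, hmin0⟩ := (isCompact_Icc.prod isCompact_Icc).exists_isMinOn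
    ⟨(t, y), ⟨ht, hT1t.le⟩, abs_le.1 hy⟩ hwc
  have hs : w (t0, y0) ≤ w (t, y) := hmin0 ⟨⟨ht, hT1t.le⟩, abs_le.1 hy⟩
  set s := w (t0, y0) with hsdef
  have hs0 : s < 0 := hs.trans_lt hwneg
  simp only [mem_Icc] at ht0 hy0
  have hu0 : u t0 y0 < 0 := by
    by_contra! h
    have : 0 ≤ s := div_nonneg (mul_nonneg h (Real.exp_pos _).le) (hH y0 (abs_le.2 hy0)).le
    linarith
  have a1 : T < t0 := lt_of_le_of_ne ht0.1 fun h => by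
    rw [← h] at hu0; linarith [hT y0 (abs_le.2 hy0)]
  have a2 : t0 < T1 := lt_of_le_of_ne ht0.2 fun h => by
    have := hwT1 y0 (abs_le.2 hy0)
    rw [← h] at this; linarith
  have a3 : -l < y0 := lt_of_le_of_ne hy0.1 fun h => by
    rw [← h] at hu0; linarith [hl2 t0 ht0.1]
  have a4 : y0 < l := lt_of_le_of_ne hy0.2 fun h => by
    rw [h] at hu0; linarith [hl1 t0 ht0.1]
  have hge : ∀ t y, t ∈ Icc T T1 → y ∈ Icc (-l) l → s * (Real.exp (σ * t) * H y) ≤ u t y := by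
    intro t y ht hy
    have h1 : s ≤ w (t, y) := hmin0 ⟨ht, hy⟩
    have h2 := hH y (abs_le.2 hy)
    have h3 : u t y = w (t, y) * (Real.exp (σ * t) * H y) := by
      simp only [hw]
      have := Real.exp_pos (σ * t)
      rw [Real.exp_neg]; field_simp
    rw [h3]
    exact mul_le_mul_of_nonneg_right h1 (by positivity)
  have heq : u t0 y0 = s * (Real.exp (σ * t0) * H y0) := by
    have h2 := hH y0 (abs_le.2 hy0)
    simp only [hsdef, hw]
    have := Real.exp_pos (σ * t0)
    rw [Real.exp_neg]; field_simp
  have hexp : ∀ t, HasDerivAt (fun t => Real.exp (σ * t)) (σ * Real.exp (σ * t)) t := fun t => by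
    have := ((hasDerivAt_id t).const_mul σ).exp
    simpa [mul_comm] using this
  have b1 : 0 ≤ utt t0 y0 - s * (σ * (σ * Real.exp (σ * t0)) * H y0) := by
    refine deriv_deriv_nonneg_of_isLocalMin (f := fun t => u t y0 - s * (Real.exp (σ * t) * H y0))
      (f1 := fun t => ut t y0 - s * (σ * Real.exp (σ * t) * H y0)) (x := t0)
      (fun t => (hu.t1 t y0).sub (((hexp t).mul_const _).const_mul s))
      ((hu.t2 t0 y0).sub ((((hexp t0).const_mul σ).mul_const _).const_mul s)) ?_
    filter_upwards [Ioo_mem_nhds a1 a2] with t ht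
    rw [heq, sub_self, sub_nonneg]
    exact hge t y0 ⟨ht.1.le, ht.2.le⟩ hy0
  have b2 : 0 ≤ uyy t0 y0 - s * (Real.exp (σ * t0) * H2 y0) := by
    refine deriv_deriv_nonneg_of_isLocalMin (f := fun y => u t0 y - s * (Real.exp (σ * t0) * H y))
      (f1 := fun y => uy t0 y - s * (Real.exp (σ * t0) * H1 y)) (x := y0)
      (fun y => (hu.y1 t0 y).sub (((hH1 y).const_mul _).const_mul s))
      ((hu.y2 t0 y0).sub (((hH2 y0).const_mul _).const_mul s)) ?_
    filter_upwards [Ioo_mem_nhds a3 a4] with y hy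
    rw [heq, sub_self, sub_nonneg]
    exact hge t0 y ht0 ⟨hy.1.le, hy.2.le⟩
  have c1 := hle t0 y0 ht0.1 (abs_le.2 hy0)
  have c2 := hlt t0 y0 ht0.1 (abs_le.2 hy0)
  have c3 : 0 < s * Real.exp (σ * t0)
      * (δ * (σ ^ 2 * H y0) + H2 y0 + (1 + q t0 y0) * H y0) :=
    mul_pos_of_neg_of_neg (mul_neg_of_neg_of_pos hs0 (Real.exp_pos _)) c2
  have c4 := mul_nonneg hδ b1
  rw [heq] at c1
  linarith

/-- Exponential lower bound for solutions in a half-strip. -/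
lemma exp_mul_cos_le {u ut utt uy uyy q : ℝ → ℝ → ℝ} {H H1 H2 : ℝ → ℝ} {δ σ T B κ lam : ℝ}
    (hu : Deriv2 u ut utt uy uyy) (hσ : 0 < σ) (hδ : 0 ≤ δ) (hκ : 0 ≤ κ) (hlam : 0 ≤ lam)
    (hB : ∀ t y, T ≤ t → |u t y| ≤ B)
    (hT : ∀ y, |y| ≤ Real.pi / 2 → κ * Real.cos y ≤ u T y)
    (hl1 : ∀ t, 0 ≤ u t (Real.pi / 2)) (hl2 : ∀ t, 0 ≤ u t (-(Real.pi / 2)))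
    (hH1 : ∀ y, HasDerivAt H (H1 y) y) (hH2 : ∀ y, HasDerivAt H1 (H2 y) y)
    (hH : ∀ y, |y| ≤ Real.pi / 2 → 0 < H y)
    (heq : ∀ t y, δ * utt t y + uyy t y + (1 + δ * q t y) * u t y = 0)
    (hq : ∀ t y, T ≤ t → |y| ≤ Real.pi / 2 → -lam ^ 2 ≤ q t y)
    (hlt : ∀ t y, T ≤ t → |y| ≤ Real.pi / 2 →
      δ * (σ ^ 2 * H y) + H2 y + (1 + δ * q t y) * H y < 0)
    {t y : ℝ} (ht : T ≤ t) (hy : |y| ≤ Real.pi / 2) :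
    κ * Real.exp (-(lam * (t - T))) * Real.cos y ≤ u t y := by
  have hexp : ∀ t, HasDerivAt (fun t => Real.exp (-(lam * (t - T))))
      (-lam * Real.exp (-(lam * (t - T)))) t := fun t => by
    have := (((hasDerivAt_id t).sub_const T).const_mul lam).neg.exp
    simpa [mul_comm] using this
  have hv : Deriv2 (fun t y => u t y - κ * Real.exp (-(lam * (t - T))) * Real.cos y)
      (fun t y => ut t y - κ * (-lam * Real.exp (-(lam * (t - T)))) * Real.cos y)
      (fun t y => utt t y - κ * (-lam * (-lam * Real.exp (-(lam * (t - T))))) * Real.cos y)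
      (fun t y => uy t y - κ * Real.exp (-(lam * (t - T))) * (-Real.sin y))
      (fun t y => uyy t y - κ * Real.exp (-(lam * (t - T))) * (-Real.cos y)) :=
    { cont := hu.cont.sub (by fun_prop)
      t1 := fun t y => (hu.t1 t y).sub (((hexp t).const_mul κ).mul_const _)
      t2 := fun t y => (hu.t2 t y).sub ((((hexp t).const_mul (-lam)).const_mul κ).mul_const _)
      y1 := fun t y => (hu.y1 t y).sub ((Real.hasDerivAt_cos y).const_mul _)
      y2 := fun t y => (hu.y2 t y).sub ((Real.hasDerivAt_sin y).neg.const_mul _) }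
  have hcos : ∀ y, |y| ≤ Real.pi / 2 → 0 ≤ Real.cos y := fun y hy =>
    Real.cos_nonneg_of_neg_pi_div_two_le_of_le (abs_le.1 hy).1 (abs_le.1 hy).2
  have hmain := nonneg_of_supersolution (q := fun t y => δ * q t y) (B := B + κ) hv hσ hδ
    (by positivity) (fun t y ht => ?_) (fun y hy => ?_) (fun t _ => ?_) (fun t _ => ?_) hH1 hH2 hH
    (fun t y ht hy => ?_) hlt ht hy
  · linarith
  · refine (abs_sub _ _).trans (add_le_add (hB t y ht) ?_)
    rw [abs_mul, abs_of_nonneg (by positivity : 0 ≤ κ * Real.exp (-(lam * (t - T))))]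
    have h1 : Real.exp (-(lam * (t - T))) ≤ 1 := Real.exp_le_one_iff.2 (by
      have := mul_nonneg hlam (sub_nonneg.2 ht); linarith)
    calc κ * Real.exp (-(lam * (t - T))) * |Real.cos y| ≤ κ * 1 * 1 := by
          gcongr; exact Real.abs_cos_le_one y
      _ = κ := by ring
  · have := hT y hy
    simpa using this
  · simpa using hl1 t
  · simpa using hl2 t
  · have h1 := heq t y
    have h2 : 0 ≤ κ * Real.exp (-(lam * (t - T))) * Real.cos y * (δ * (lam ^ 2 + q t y)) :=
      mul_nonneg (mul_nonneg (by positivity) (hcos y hy))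
        (mul_nonneg hδ (by linarith [hq t y ht hy]))
    nlinarith

lemma cos_nonneg_of_abs_le {y : ℝ} (hy : |y| ≤ Real.pi / 2) : 0 ≤ Real.cos y :=
  Real.cos_nonneg_of_neg_pi_div_two_le_of_le (abs_le.1 hy).1 (abs_le.1 hy).2

lemma mul_sin_nonneg {y : ℝ} (hy : |y| ≤ Real.pi / 2) : 0 ≤ y * Real.sin y := by
  have := abs_le.1 hy
  rcases le_total 0 y with h | h
  · exact mul_nonneg h (Real.sin_nonneg_of_nonneg_of_le_pi h (by linarith [Real.pi_pos]))
  · exact mul_nonneg_of_nonpos_of_nonpos h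
      (Real.sin_nonpos_of_nonpos_of_neg_pi_le h (by linarith [Real.pi_pos]))

lemma mul_sin_le {y : ℝ} (hy : |y| ≤ Real.pi / 2) : y * Real.sin y ≤ 2 := by
  refine (le_abs_self _).trans ?_
  rw [abs_mul]
  have h1 := Real.abs_sin_le_one y
  have h2 : |y| ≤ 2 := hy.trans (by linarith [Real.pi_le_four])
  nlinarith [abs_nonneg y, abs_nonneg (Real.sin y)]

lemma le_mul_sin {y : ℝ} (hy : |y| ≤ Real.pi / 2) (hc : Real.cos y < 1 / 2) :
    4 / 5 ≤ y * Real.sin y := by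
  have h0 := mul_sin_nonneg hy
  have h1 := Real.one_sub_sq_div_two_le_cos (x := y)
  have h2 := Real.sin_sq_add_cos_sq y
  have h3 := cos_nonneg_of_abs_le hy
  have h4 : 1 < y ^ 2 := by linarith
  have h5 : 3 / 4 < Real.sin y ^ 2 := by nlinarith
  have h6 : 3 / 4 < (y * Real.sin y) ^ 2 := by rw [mul_pow]; nlinarith
  by_contra! h
  nlinarith

lemma hasDerivAt_mul_sin (y : ℝ) :
    HasDerivAt (fun y => y * Real.sin y) (Real.sin y + y * Real.cos y) y :=
  ((hasDerivAt_id y).mul (Real.hasDerivAt_sin y)).congr_deriv (by simp)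

lemma hasDerivAt_mul_cos (y : ℝ) :
    HasDerivAt (fun y => y * Real.cos y) (Real.cos y - y * Real.sin y) y :=
  ((hasDerivAt_id y).mul (Real.hasDerivAt_cos y)).congr_deriv (by simp; ring)

/-- Lower bound where the potential is close to the limit on the right. -/
lemma exp_mul_cos_le_right {u ut utt uy uyy q : ℝ → ℝ → ℝ} {δ T B κ : ℝ}
    (hu : Deriv2 u ut utt uy uyy) (hδ : 0 < δ) (hδ1 : δ ≤ 1 / 1000) (hκ : 0 ≤ κ)
    (hB : ∀ t y, T ≤ t → |u t y| ≤ B)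
    (hT : ∀ y, |y| ≤ Real.pi / 2 → κ * Real.cos y ≤ u T y)
    (hl1 : ∀ t, 0 ≤ u t (Real.pi / 2)) (hl2 : ∀ t, 0 ≤ u t (-(Real.pi / 2)))
    (heq : ∀ t y, δ * utt t y + uyy t y + (1 + δ * q t y) * u t y = 0)
    (hq : ∀ t y, T ≤ t → |y| ≤ Real.pi / 2 →
      |q t y - (-1 + 16 * Real.cos y ^ 2 - 24 * Real.cos y ^ 4)| ≤ 1 / 8)
    {t y : ℝ} (ht : T ≤ t) (hy : |y| ≤ Real.pi / 2) :
    κ * Real.exp (-(4 * (t - T))) * Real.cos y ≤ u t y := by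
  have hpow : ∀ y, |y| ≤ Real.pi / 2 → 0 ≤ Real.cos y ∧ Real.cos y ≤ 1 ∧
      0 ≤ Real.cos y ^ 2 ∧ Real.cos y ^ 2 ≤ 1 ∧ 0 ≤ Real.cos y ^ 3 ∧ Real.cos y ^ 3 ≤ 1 ∧
      0 ≤ Real.cos y ^ 4 ∧ Real.cos y ^ 4 ≤ 1 ∧ 0 ≤ Real.cos y ^ 5 ∧ Real.cos y ^ 5 ≤ 1 :=
    fun y hy => by
      have h0 := cos_nonneg_of_abs_le hy
      have h1 := Real.cos_le_one y
      exact ⟨h0, h1, by positivity, pow_le_one₀ h0 h1, by positivity, pow_le_one₀ h0 h1,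
        by positivity, pow_le_one₀ h0 h1, by positivity, pow_le_one₀ h0 h1⟩
  refine exp_mul_cos_le (σ := 1 / 2) (q := q) (B := B)
    (H := fun y => Real.cos y + δ * (-Real.cos y ^ 5 - 1 / 2 * Real.cos y ^ 3
      + 2 * (y * Real.sin y) - 1))
    (H1 := fun y => -Real.sin y + δ * (5 * Real.cos y ^ 4 * Real.sin y
      + 3 / 2 * Real.cos y ^ 2 * Real.sin y + 2 * (Real.sin y + y * Real.cos y)))
    (H2 := fun y => -Real.cos y + δ * (-20 * Real.cos y ^ 3 * Real.sin y ^ 2 + 5 * Real.cos y ^ 5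
      - 3 * Real.cos y * Real.sin y ^ 2 + 3 / 2 * Real.cos y ^ 3
      + 2 * (Real.cos y + (Real.cos y - y * Real.sin y))))
    hu (by norm_num) hδ.le hκ (by norm_num) hB hT hl1 hl2 (fun y => ?_) (fun y => ?_)
    (fun y hy => ?_) heq (fun t y ht hy => ?_) (fun t y ht hy => ?_) ht hy
  · have hc := Real.hasDerivAt_cos y
    refine (hc.add ((((hc.pow 5).neg.sub ((hc.pow 3).const_mul (1 / 2))).add
      ((hasDerivAt_mul_sin y).const_mul 2)).sub_const 1 |>.const_mul δ)).congr_deriv ?_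
    simp only [Nat.cast_ofNat, Nat.reduceSub]
    ring
  · have hc := Real.hasDerivAt_cos y
    have hs := Real.hasDerivAt_sin y
    refine (hs.neg.add ((((((hc.pow 4).const_mul 5).mul hs).add
      (((hc.pow 2).const_mul (3 / 2)).mul hs)).add
      ((hs.add (hasDerivAt_mul_cos y)).const_mul 2)).const_mul δ)).congr_deriv ?_
    simp only [Nat.cast_ofNat, Nat.reduceSub, Pi.pow_apply]
    ring
  · obtain ⟨h0, h1, h2, h3, h4, h5, h6, h7, h8, h9⟩ := hpow y hy
    rcases lt_or_ge (Real.cos y) (1 / 2) with hc | hc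
    · have h10 := le_mul_sin hy hc
      have h11 : Real.cos y ^ 3 ≤ 1 / 8 := by
        calc Real.cos y ^ 3 ≤ (1 / 2) ^ 3 := by gcongr
          _ = _ := by norm_num
      have h12 : Real.cos y ^ 5 ≤ 1 / 32 := by
        calc Real.cos y ^ 5 ≤ (1 / 2) ^ 5 := by gcongr
          _ = _ := by norm_num
      have : 0 < δ * (-Real.cos y ^ 5 - 1 / 2 * Real.cos y ^ 3 + 2 * (y * Real.sin y) - 1) :=
        mul_pos hδ (by linarith)
      linarith
    · have h10 := mul_sin_nonneg hy
      have : δ * (-3) ≤ δ * (-Real.cos y ^ 5 - 1 / 2 * Real.cos y ^ 3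
        + 2 * (y * Real.sin y) - 1) := mul_le_mul_of_nonneg_left (by linarith) hδ.le
      linarith
  · obtain ⟨h0, h1, h2, h3, h4, h5, h6, h7, h8, h9⟩ := hpow y hy
    have := (abs_le.1 (hq t y ht hy)).1
    have h10 : Real.cos y ^ 4 ≤ Real.cos y ^ 2 := pow_le_pow_of_le_one h0 h1 (by norm_num)
    norm_num; linarith
  · obtain ⟨h0, h1, h2, h3, h4, h5, h6, h7, h8, h9⟩ := hpow y hy
    have hq' := abs_le.1 (hq t y ht hy)
    have hys := mul_sin_le hy
    have hys0 := mul_sin_nonneg hy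
    set r := q t y - (-1 + 16 * Real.cos y ^ 2 - 24 * Real.cos y ^ 4) with hr
    have hqr : q t y = -1 + 16 * Real.cos y ^ 2 - 24 * Real.cos y ^ 4 + r := by rw [hr]; ring
    set h := -Real.cos y ^ 5 - 1 / 2 * Real.cos y ^ 3 + 2 * (y * Real.sin y) - 1 with hh
    have hha : |h| ≤ 4 := abs_le.2 ⟨by linarith, by linarith⟩
    have hqa : |q t y| ≤ 26 := abs_le.2 ⟨by linarith, by linarith⟩
    have hqh : q t y * h ≤ 104 := by
      refine (le_abs_self _).trans ?_
      rw [abs_mul]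
      nlinarith [abs_nonneg h, abs_nonneg (q t y)]
    have hrc : r * Real.cos y ≤ 1 / 8 := by nlinarith
    have hs : Real.sin y ^ 2 = 1 - Real.cos y ^ 2 := by linarith [Real.sin_sq_add_cos_sq y]
    have key : δ * ((1 / 2) ^ 2 * (Real.cos y + δ * h)) + (-Real.cos y
        + δ * (-20 * Real.cos y ^ 3 * Real.sin y ^ 2 + 5 * Real.cos y ^ 5
      - 3 * Real.cos y * Real.sin y ^ 2 + 3 / 2 * Real.cos y ^ 3
      + 2 * (Real.cos y + (Real.cos y - y * Real.sin y))))
      + (1 + δ * q t y) * (Real.cos y + δ * h)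
      = δ * (1 / 4 * Real.cos y - 1 + r * Real.cos y + δ * (1 / 4 * h + q t y * h)) := by
      rw [hs]
      linear_combination δ * Real.cos y * hqr + δ * hh
    rw [key]
    refine mul_neg_of_pos_of_neg hδ ?_
    have h4' := (abs_le.1 hha).2
    have : δ * (1 / 4 * h + q t y * h) ≤ δ * 105 :=
      mul_le_mul_of_nonneg_left (by linarith) hδ.le
    linarith

/-- Lower bound where the potential is bounded away from zero, as on the left. -/
lemma exp_mul_cos_le_left {u ut utt uy uyy q : ℝ → ℝ → ℝ} {δ T B κ : ℝ}
    (hu : Deriv2 u ut utt uy uyy) (hδ : 0 < δ) (hδ1 : δ ≤ 1 / 1000) (hκ : 0 ≤ κ)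
    (hB : ∀ t y, T ≤ t → |u t y| ≤ B)
    (hT : ∀ y, |y| ≤ Real.pi / 2 → κ * Real.cos y ≤ u T y)
    (hl1 : ∀ t, 0 ≤ u t (Real.pi / 2)) (hl2 : ∀ t, 0 ≤ u t (-(Real.pi / 2)))
    (heq : ∀ t y, δ * utt t y + uyy t y + (1 + δ * q t y) * u t y = 0)
    (hq : ∀ t y, T ≤ t → |y| ≤ Real.pi / 2 → -16 ≤ q t y ∧ q t y ≤ -1 / 2)
    {t y : ℝ} (ht : T ≤ t) (hy : |y| ≤ Real.pi / 2) :
    κ * Real.exp (-(4 * (t - T))) * Real.cos y ≤ u t y := by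
  have hpos : ∀ y, |y| ≤ Real.pi / 2 →
      0 < Real.cos y + δ * (1 / 8 * (2 * (y * Real.sin y) - 1)) := fun y hy => by
    have h0 := cos_nonneg_of_abs_le hy
    rcases lt_or_ge (Real.cos y) (1 / 2) with hc | hc
    · have h10 := le_mul_sin hy hc
      have : 0 < δ * (1 / 8 * (2 * (y * Real.sin y) - 1)) := mul_pos hδ (by linarith)
      linarith
    · have h10 := mul_sin_nonneg hy
      have : δ * (-1) ≤ δ * (1 / 8 * (2 * (y * Real.sin y) - 1)) :=
        mul_le_mul_of_nonneg_left (by linarith) hδ.le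
      linarith
  refine exp_mul_cos_le (σ := 1 / 4) (q := q) (B := B)
    (H := fun y => Real.cos y + δ * (1 / 8 * (2 * (y * Real.sin y) - 1)))
    (H1 := fun y => -Real.sin y + δ * (1 / 8 * (2 * (Real.sin y + y * Real.cos y))))
    (H2 := fun y => -Real.cos y + δ * (1 / 8 * (2 * (Real.cos y
      + (Real.cos y - y * Real.sin y)))))
    hu (by norm_num) hδ.le hκ (by norm_num) hB hT hl1 hl2
    (fun y => (Real.hasDerivAt_cos y).add (((((hasDerivAt_mul_sin y).const_mul 2).sub_const
      1).const_mul (1 / 8)).const_mul δ))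
    (fun y => (Real.hasDerivAt_sin y).neg.add (((((Real.hasDerivAt_sin y).add
      (hasDerivAt_mul_cos y)).const_mul 2).const_mul (1 / 8)).const_mul δ))
    hpos heq (fun t y ht hy => ?_) (fun t y ht hy => ?_) ht hy
  · have := (hq t y ht hy).1
    norm_num; linarith
  · have h0 := cos_nonneg_of_abs_le hy
    have h1 := Real.cos_le_one y
    have hys0 := mul_sin_nonneg hy
    have hp := hpos y hy
    have hq' := (hq t y ht hy).2
    set h := 1 / 8 * (2 * (y * Real.sin y) - 1) with hh
    have key : δ * ((1 / 4) ^ 2 * (Real.cos y + δ * h)) + (-Real.cos y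
        + δ * (1 / 8 * (2 * (Real.cos y + (Real.cos y - y * Real.sin y)))))
        + (1 + δ * q t y) * (Real.cos y + δ * h)
        = δ * (1 / 16 * (Real.cos y + δ * h) + (4 * Real.cos y - 1) / 8
          + q t y * (Real.cos y + δ * h)) := by
      linear_combination δ * hh
    rw [key]
    refine mul_neg_of_pos_of_neg hδ ?_
    have h2 : q t y * (Real.cos y + δ * h) ≤ -1 / 2 * (Real.cos y + δ * h) :=
      mul_le_mul_of_nonneg_right hq' hp.le
    have h3 : δ * (-(1 / 8)) ≤ δ * h := mul_le_mul_of_nonneg_left (by linarith) hδ.le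
    linarith

/-- Fourier coefficients, with three derivatives, of a solution of
`ε² Ψ_tt + Ψ_yy + Ψ = ε² G(Ψ)` close to `front t * cos y`. -/
structure Modes (ε μ E : ℝ) (c c1 c2 c3 : Seq) : Prop where
  good : ∀ n, Good n c
  good1 : ∀ n, Good n c1
  rapid2 : Rapid c2
  rapid3 : Rapid c3
  d0 : ∀ m t, HasDerivAt (c m) (c1 m t) t
  d1 : ∀ m t, HasDerivAt (c1 m) (c2 m t) t
  d2 : ∀ m t, HasDerivAt (c2 m) (c3 m t) t
  even : ∀ m t, c (-m) t = c m t
  odd : ∀ m t, Even m → c m t = 0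
  eq : ∀ m t, c2 m t = ((m : ℝ) ^ 2 - 1) / ε ^ 2 * c m t + nl μ c m t
  close : ∀ m t, |c m t - (if m.natAbs = 1 then front t / 2 else 0)| ≤ E * wt m
  close1 : ∀ m t, |c1 m t - (if m.natAbs = 1 then frontD t / 2 else 0)| ≤ E * wt m

lemma frontD_le_one (t : ℝ) : frontD t ≤ 1 := by
  have h1 := front_pos t
  have h2 := front_lt_one t
  have h3 : 0 < front t ^ 3 := by positivity
  unfold frontD; linarith

lemma baseD_le (m : ℤ) (t : ℝ) :
    |(if m.natAbs = 1 then frontD t / 2 else 0 : ℝ)| ≤ 2 * wt m := by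
  split_ifs with h
  · have hw : wt m = 1 / 4 := by
      rcases Int.natAbs_eq_iff.1 h with h | h <;> simp only [h, Nat.cast_one, wt_neg, wt_one]
    rw [hw, abs_of_pos (by have := frontD_pos t; linarith)]
    linarith [frontD_le_one t]
  · have := wt_pos m
    simp only [abs_zero]; linarith

theorem exists_modes : ∃ K ε₀ : ℝ, 0 < K ∧ 0 < ε₀ ∧ ∀ ε, 0 < ε → ε < ε₀ →
    ∃ (μ : ℝ) (c c1 c2 c3 : Seq), |μ| ≤ K * ε ∧ Modes ε μ (K * ε) c c1 c2 c3 := by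
  obtain ⟨K, ε₀, hK, hε₀, h⟩ := exists_coeffs
  refine ⟨K, ε₀, hK, hε₀, fun ε hε hεε => ?_⟩
  obtain ⟨μ, β, c1, hμ, he, ho, h1, h2, hb, hb1⟩ := h ε hε hεε
  have hr : Rapid (cf β) := rapid_of_abs_le_wt (continuous_cf β)
    fun m t => (abs_cf_le β m t).trans_eq (mul_comm _ _)
  have hr1 : Rapid c1 := rapid_of_abs_le_wt (K := K * ε + 2)
    (fun m => continuous_iff_continuousAt.2 fun t => (h2 m t).continuousAt) fun m t => by
      have e1 := hb1 m t
      have e2 := baseD_le m t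
      have e3 := abs_sub_abs_le_abs_sub (c1 m t) (baseD m t)
      change |baseD m t| ≤ _ at e2
      linarith
  have hg := good_of_ode hr hr1 h1 h2
  have hg1 : ∀ n, Good n c1 := fun n => (hg (n + 1)).deriv h1
  have hg2 : Good 1 (fun m t => ((m : ℝ) ^ 2 - 1) / ε ^ 2 * cf β m t + nl μ (cf β) m t) :=
    (hg1 2).deriv h2
  obtain ⟨hr2, c3, h3, hr3⟩ := hg2
  refine ⟨μ, cf β, c1, _, c3, hμ, hg, hg1, hr2, hr3, h1, h2, h3, he, ho, fun _ _ => rfl,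
    fun m t => ?_, hb1⟩
  simpa only [cf_baseV] using hb m t

lemma Deriv2.reflect {u ut utt uy uyy : ℝ → ℝ → ℝ} (h : Deriv2 u ut utt uy uyy) :
    Deriv2 (fun t y => u (-t) y) (fun t y => -ut (-t) y) (fun t y => utt (-t) y)
      (fun t y => uy (-t) y) (fun t y => uyy (-t) y) where
  cont := h.cont.comp (continuous_fst.neg.prodMk continuous_snd)
  t1 t y := ((h.t1 (-t) y).comp t (hasDerivAt_neg t)).congr_deriv (by ring)
  t2 t y := ((h.t2 (-t) y).comp t (hasDerivAt_neg t)).neg.congr_deriv (by ring)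
  y1 t y := h.y1 (-t) y
  y2 t y := h.y2 (-t) y

lemma deriv2_synth {c c1 c2 : Seq} (hc : Rapid c) (hc1 : Rapid c1) (hc2 : Rapid c2)
    (h1 : ∀ m t, HasDerivAt (c m) (c1 m t) t) (h2 : ∀ m t, HasDerivAt (c1 m) (c2 m t) t) :
    Deriv2 (synth 0 c) (synth 0 c1) (synth 0 c2) (synth (0 + Real.pi / 2) (dy c))
      (synth (0 + Real.pi / 2 + Real.pi / 2) (dy (dy c))) where
  cont := hc.continuous_synth 0
  t1 t y := hasDerivAt_synth_fst hc hc1 h1 0 t y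
  t2 t y := hasDerivAt_synth_fst hc1 hc2 h2 0 t y
  y1 t y := hasDerivAt_synth_snd hc hc1 h1 0 t y
  y2 t y := hasDerivAt_synth_snd hc.dy hc1.dy (fun m t => (h1 m t).const_mul (m : ℝ)) _ t y

lemma synth_pi_div_two {c : Seq} (hodd : ∀ m t, Even m → c m t = 0) (t : ℝ) :
    synth 0 c t (Real.pi / 2) = 0 := by
  have h := synth_add_pi hodd 0 t (-(Real.pi / 2))
  rw [synth_neg, show -(Real.pi / 2) + Real.pi = Real.pi / 2 by ring] at h
  linarith

lemma le_of_abs_sub_le {x a r C : ℝ} (h : |x - a * C| ≤ r * |C|) (hC : 0 ≤ C) :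
    (a - r) * C ≤ x ∧ x ≤ (a + r) * C := by
  rw [abs_of_nonneg hC] at h
  have := abs_le.1 h
  constructor <;> linarith

lemma abs_potential_sub_le {μ Ψ C : ℝ} (hμ : |μ| ≤ 1 / 10000) (hC0 : 0 ≤ C) (hC1 : C ≤ 1)
    (h : |Ψ - C| ≤ 1 / 10000) :
    |-(1 - 16 * Ψ ^ 2 + 24 * (1 + μ) * Ψ ^ 4) - (-1 + 16 * C ^ 2 - 24 * C ^ 4)| ≤ 1 / 8 := by
  obtain ⟨r, rfl⟩ : ∃ r, Ψ = C + r := ⟨Ψ - C, by ring⟩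
  rw [add_sub_cancel_left] at h
  have hr := abs_le.1 h
  have hs : |2 * C + r| ≤ 3 := abs_le.2 ⟨by linarith, by linarith⟩
  have h2 : |(C + r) ^ 2 - C ^ 2| ≤ 3 / 10000 := by
    rw [show (C + r) ^ 2 - C ^ 2 = r * (2 * C + r) by ring, abs_mul]
    calc |r| * |2 * C + r| ≤ 1 / 10000 * 3 := by gcongr
      _ = _ := by norm_num
  set P := (C + r) ^ 2 with hP
  have hC2 : C ^ 2 ≤ 1 := pow_le_one₀ hC0 hC1
  have hC2' : 0 ≤ C ^ 2 := by positivity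
  have hP2 := abs_le.1 h2
  have h4 : |P ^ 2 - (C ^ 2) ^ 2| ≤ 9 / 10000 := by
    rw [show P ^ 2 - (C ^ 2) ^ 2 = (P - C ^ 2) * (P + C ^ 2) by ring, abs_mul]
    calc |P - C ^ 2| * |P + C ^ 2| ≤ 3 / 10000 * 3 := by
          gcongr
          exact abs_le.2 ⟨by linarith, by linarith⟩
      _ = _ := by norm_num
  have h4' := abs_le.1 h4
  have hP4 : |P ^ 2| ≤ 2 := abs_le.2 ⟨by nlinarith, by nlinarith⟩
  have h5 : |μ * P ^ 2| ≤ 2 / 10000 := by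
    rw [abs_mul]
    calc |μ| * |P ^ 2| ≤ 1 / 10000 * 2 := by gcongr
      _ = _ := by norm_num
  have h5' := abs_le.1 h5
  rw [show (C + r) ^ 4 = P ^ 2 by rw [hP]; ring, show C ^ 4 = (C ^ 2) ^ 2 by ring]
  exact abs_le.2 ⟨by linarith, by linarith⟩

variable {ε μ E : ℝ} {c c1 c2 c3 : Seq}

lemma Modes.odd1 (h : Modes ε μ E c c1 c2 c3) (m : ℤ) (t : ℝ) (hm : Even m) : c1 m t = 0 := by
  have e : c m = fun _ => 0 := funext fun s => h.odd m s hm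
  have h1 := h.d0 m t
  rw [e] at h1
  exact h1.unique (hasDerivAt_const t 0)

lemma Modes.abs_sub_le (h : Modes ε μ E c c1 c2 c3) (t y : ℝ) :
    |synth 0 c t y - front t * Real.cos y| ≤ E * sumConst * |Real.cos y| :=
  abs_synth_sub_le (h.good 0).rapid h.odd (fun m => h.close m t) y

lemma Modes.abs_sub_le1 (h : Modes ε μ E c c1 c2 c3) (t y : ℝ) :
    |synth 0 c1 t y - frontD t * Real.cos y| ≤ E * sumConst * |Real.cos y| :=
  abs_synth_sub_le (h.good1 0).rapid h.odd1 (fun m => h.close1 m t) y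

lemma Modes.deriv2 (h : Modes ε μ E c c1 c2 c3) :
    Deriv2 (synth 0 c) (synth 0 c1) (synth 0 c2) (synth (0 + Real.pi / 2) (dy c))
      (synth (0 + Real.pi / 2 + Real.pi / 2) (dy (dy c))) :=
  deriv2_synth (h.good 0).rapid (h.good1 0).rapid h.rapid2 h.d0 h.d1

lemma Modes.deriv2' (h : Modes ε μ E c c1 c2 c3) :
    Deriv2 (synth 0 c1) (synth 0 c2) (synth 0 c3) (synth (0 + Real.pi / 2) (dy c1))
      (synth (0 + Real.pi / 2 + Real.pi / 2) (dy (dy c1))) :=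
  deriv2_synth (h.good1 0).rapid h.rapid2 h.rapid3 h.d1 h.d2

/-- Smallness conditions on the parameters. -/
structure Small (ε μ r T : ℝ) : Prop where
  eps_pos : 0 < ε
  eps_sq : ε ^ 2 ≤ 1 / 1000
  mu : |μ| ≤ 1 / 10000
  r_le : r ≤ 1 / 20000
  T_nonneg : 0 ≤ T
  right : ∀ t, T ≤ t → 1 - 1 / 20000 ≤ front t
  left : ∀ t, t ≤ -T → front t ≤ 1 / 20
  frontD_lt : ∀ t, -T ≤ t → t ≤ T → r < frontD t
  front_lt : ∀ t, -T ≤ t → r < front t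

lemma Modes.abs_le_left (h : Modes ε μ E c c1 c2 c3) {T : ℝ} (hs : Small ε μ (E * sumConst) T)
    {t y : ℝ} (ht : t ≤ -T) : synth 0 c t y ^ 2 ≤ 1 / 100 := by
  have h1 := h.abs_sub_le t y
  have h2 : |synth 0 c t y| ≤ 1 / 10 := by
    have h3 := abs_sub_abs_le_abs_sub (synth 0 c t y) (front t * Real.cos y)
    have h4 : |front t * Real.cos y| ≤ front t := by
      rw [abs_mul, abs_of_pos (front_pos t)]
      exact mul_le_of_le_one_right (front_pos t).le (Real.abs_cos_le_one y)
    have h5 : E * sumConst * |Real.cos y| ≤ 1 / 20000 := by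
      have := hs.r_le
      nlinarith [abs_nonneg (Real.cos y), Real.abs_cos_le_one y]
    linarith [hs.left t ht]
  have := sq_le_sq' (abs_le.1 h2).1 (abs_le.1 h2).2
  linarith

lemma Modes.exists_mul_cos_le_deriv (h : Modes ε μ E c c1 c2 c3) {T : ℝ}
    (hs : Small ε μ (E * sumConst) T) (t : ℝ) :
    ∃ κ, 0 < κ ∧ ∀ y, |y| ≤ Real.pi / 2 → κ * Real.cos y ≤ synth 0 c1 t y := by
  have hmid : ∀ t y, |y| ≤ Real.pi / 2 →
      (frontD t - E * sumConst) * Real.cos y ≤ synth 0 c1 t y := fun t y hy =>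
    (le_of_abs_sub_le (h.abs_sub_le1 t y) (cos_nonneg_of_abs_le hy)).1
  have hv := synth_pi_div_two h.odd1
  have hv' : ∀ t, synth 0 c1 t (-(Real.pi / 2)) = 0 := fun t => by rw [synth_neg, hv]
  obtain ⟨B, hB⟩ := (h.good1 0).rapid.exists_abs_synth_le
  have hδ : 0 < ε ^ 2 := pow_pos hs.eps_pos 2
  have heq : ∀ t y, ε ^ 2 * synth 0 c3 t y + synth (0 + Real.pi / 2 + Real.pi / 2) (dy (dy c1)) t y
      + (1 + ε ^ 2 * -(1 - 16 * synth 0 c t y ^ 2 + 24 * (1 + μ) * synth 0 c t y ^ 4))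
        * synth 0 c1 t y = 0 := fun t y => by
    have := synth_eq_deriv hs.eps_pos.ne' (h.good 0).rapid (h.good1 0).rapid h.rapid2 h.rapid3
      h.even h.d0 h.d2 h.eq t y
    linarith
  have hT := hs.T_nonneg
  rcases le_total T t with ht | ht
  · have hκ : 0 < frontD T - E * sumConst := by
      linarith [hs.frontD_lt T (by linarith) le_rfl]
    refine ⟨(frontD T - E * sumConst) * Real.exp (-(4 * (t - T))), by positivity, fun y hy => ?_⟩
    refine exp_mul_cos_le_right
      (q := fun t y => -(1 - 16 * synth 0 c t y ^ 2 + 24 * (1 + μ) * synth 0 c t y ^ 4))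
      h.deriv2' hδ hs.eps_sq hκ.le (fun t y _ => hB 0 t y) (hmid T)
      (fun t => (hv t).ge) (fun t => (hv' t).ge) heq (fun t y ht hy => ?_) ht hy
    have hc0 := cos_nonneg_of_abs_le hy
    have hc1 := Real.cos_le_one y
    refine abs_potential_sub_le hs.mu hc0 hc1 ?_
    have h1 := h.abs_sub_le t y
    rw [abs_of_nonneg hc0] at h1
    have h2 := abs_le.1 h1
    have h3 : E * sumConst * Real.cos y ≤ 1 / 20000 := by nlinarith [hs.r_le]
    have h4 := hs.right t ht
    have h5 := front_lt_one t
    exact abs_le.2 ⟨by nlinarith, by nlinarith⟩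
  rcases le_total (-T) t with ht' | ht'
  · exact ⟨frontD t - E * sumConst, by linarith [hs.frontD_lt t ht' ht], hmid t⟩
  · have hκ : 0 < frontD (-T) - E * sumConst := by
      linarith [hs.frontD_lt (-T) le_rfl (by linarith)]
    refine ⟨(frontD (-T) - E * sumConst) * Real.exp (-(4 * (-t - T))), by positivity,
      fun y hy => ?_⟩
    have key := exp_mul_cos_le_left
      (q := fun t y => -(1 - 16 * synth 0 c (-t) y ^ 2 + 24 * (1 + μ) * synth 0 c (-t) y ^ 4))
      h.deriv2'.reflect hδ hs.eps_sq hκ.le (fun t y _ => hB 0 (-t) y) (hmid (-T))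
      (fun t => (hv (-t)).ge) (fun t => (hv' (-t)).ge) (fun t y => heq (-t) y)
      (fun t y ht hy => ?_) (t := -t) (by linarith) hy
    · simpa only [neg_neg] using key
    · have h1 := h.abs_le_left hs (t := -t) (y := y) (by linarith)
      set P := synth 0 c (-t) y ^ 2 with hP
      have hP0 : 0 ≤ P := sq_nonneg _
      have hP4 : synth 0 c (-t) y ^ 4 = P ^ 2 := by rw [hP]; ring
      have hμ := abs_le.1 hs.mu
      simp only [hP4]
      constructor <;> nlinarith [sq_nonneg P]

lemma Modes.exists_mul_cos_le (h : Modes ε μ E c c1 c2 c3) {T : ℝ}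
    (hs : Small ε μ (E * sumConst) T) (t : ℝ) :
    ∃ κ, 0 < κ ∧ ∀ y, |y| ≤ Real.pi / 2 → κ * Real.cos y ≤ synth 0 c t y := by
  have hmid : ∀ t y, |y| ≤ Real.pi / 2 →
      (front t - E * sumConst) * Real.cos y ≤ synth 0 c t y := fun t y hy =>
    (le_of_abs_sub_le (h.abs_sub_le t y) (cos_nonneg_of_abs_le hy)).1
  rcases le_total (-T) t with ht' | ht'
  · exact ⟨front t - E * sumConst, by linarith [hs.front_lt t ht'], hmid t⟩
  have hv := synth_pi_div_two h.odd
  have hv' : ∀ t, synth 0 c t (-(Real.pi / 2)) = 0 := fun t => by rw [synth_neg, hv]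
  obtain ⟨B, hB⟩ := (h.good 0).rapid.exists_abs_synth_le
  have heq : ∀ t y, ε ^ 2 * synth 0 c2 t y + synth (0 + Real.pi / 2 + Real.pi / 2) (dy (dy c)) t y
      + (1 + ε ^ 2 * -(1 - 16 / 3 * synth 0 c t y ^ 2 + 24 / 5 * (1 + μ) * synth 0 c t y ^ 4))
        * synth 0 c t y = 0 := fun t y => by
    have := synth_eq hs.eps_pos.ne' (h.good 0).rapid h.even h.eq t y
    linarith
  have hκ : 0 < front (-T) - E * sumConst := by linarith [hs.front_lt (-T) le_rfl]
  refine ⟨(front (-T) - E * sumConst) * Real.exp (-(4 * (-t - T))), by positivity,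
    fun y hy => ?_⟩
  have key := exp_mul_cos_le_left
    (q := fun t y => -(1 - 16 / 3 * synth 0 c (-t) y ^ 2
      + 24 / 5 * (1 + μ) * synth 0 c (-t) y ^ 4))
    h.deriv2.reflect (pow_pos hs.eps_pos 2) hs.eps_sq hκ.le (fun t y _ => hB 0 (-t) y) (hmid (-T))
    (fun t => (hv (-t)).ge) (fun t => (hv' (-t)).ge) (fun t y => heq (-t) y)
    (fun t y ht hy => ?_) (t := -t) (by linarith) hy
  · simpa only [neg_neg] using key
  · have h1 := h.abs_le_left hs (t := -t) (y := y) (by linarith)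
    set P := synth 0 c (-t) y ^ 2 with hP
    have hP0 : 0 ≤ P := sq_nonneg _
    have hP4 : synth 0 c (-t) y ^ 4 = P ^ 2 := by rw [hP]; ring
    have hμ := abs_le.1 hs.mu
    simp only [hP4]
    constructor <;> nlinarith [sq_nonneg P]

/-- The choice of the parameters. -/
lemma exists_small {K : ℝ} (hK : 0 < K) {ε₀ : ℝ} (hε₀ : 0 < ε₀) :
    ∃ ε T, 0 < ε ∧ ε < ε₀ ∧ ∀ μ, |μ| ≤ K * ε → Small ε μ (K * ε * sumConst) T := by
  obtain ⟨T1, hT1⟩ := eventually_atTop.1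
    (tendsto_front_atTop.eventually (lt_mem_nhds (show (1 - 1 / 20000 : ℝ) < 1 by norm_num)))
  obtain ⟨T2, hT2⟩ := eventually_atBot.1
    (tendsto_front_atBot.eventually (gt_mem_nhds (show (0 : ℝ) < 1 / 20 by norm_num)))
  set T := max (max T1 (-T2)) 0 with hT
  have hT0 : 0 ≤ T := le_max_right _ _
  have hTT1 : T1 ≤ T := (le_max_left _ _).trans (le_max_left _ _)
  have hTT2 : -T2 ≤ T := (le_max_right _ _).trans (le_max_left _ _)
  obtain ⟨s, -, hs⟩ := (isCompact_Icc (a := -T) (b := T)).exists_isMinOn ⟨0, by simpa using hT0⟩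
    continuous_frontD.continuousOn
  have hlim : ∀ A : ℝ, Tendsto (fun ε : ℝ => A * ε) (𝓝[>] 0) (𝓝 0) := fun A => by
    have h1 : Tendsto (fun ε : ℝ => A * ε) (𝓝 0) (𝓝 (A * 0)) := tendsto_id.const_mul A
    rw [mul_zero] at h1
    exact h1.mono_left nhdsWithin_le_nhds
  have hev : ∀ A {b : ℝ}, 0 < b → ∀ᶠ ε in 𝓝[>] (0 : ℝ), A * ε < b := fun A b hb =>
    (hlim A).eventually (gt_mem_nhds hb)
  have hev0 : ∀ᶠ ε in 𝓝[>] (0 : ℝ), 0 < ε := self_mem_nhdsWithin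
  obtain ⟨ε, hε, h1, h2, h3, h4, h5, h6⟩ := (hev0.and ((hev 1 hε₀).and
    ((hev 1 (b := 1 / 1000) (by norm_num)).and ((hev K (b := 1 / 10000) (by norm_num)).and
    ((hev (K * sumConst) (b := 1 / 20000) (by norm_num)).and
    ((hev (K * sumConst) (frontD_pos s)).and (hev (K * sumConst) (front_pos (-T))))))))).exists
  rw [one_mul] at h1 h2
  rw [mul_right_comm] at h4 h5 h6
  refine ⟨ε, T, hε, h1, fun μ hμ => ⟨hε, by nlinarith, by linarith, h4.le, hT0,
    fun t ht => (hT1 t (by linarith)).le, fun t ht => (hT2 t (by linarith)).le,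
    fun t ht ht' => h5.trans_le (hs ⟨ht, ht'⟩), fun t ht =>
      h6.trans_le (front_strictMono.monotone ht)⟩⟩

/-- The solution has no critical points off the lines `cos y = 0`, and its `y`-derivative does
not vanish there. -/
lemma Modes.deriv_ne_zero (h : Modes ε μ E c c1 c2 c3) {T : ℝ}
    (hs : Small ε μ (E * sumConst) T) (t y : ℝ) :
    (Real.cos y ≠ 0 → synth 0 c1 t y ≠ 0) ∧
      (Real.cos y = 0 → synth (0 + Real.pi / 2) (dy c) t y ≠ 0) := by
  have hodd : ∀ m t, Even m → dy c m t = 0 := fun m t hm => by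
    simp only [dy, mulMode, h.odd m t hm, mul_zero]
  have key : ∀ y, y ∈ Ioc (-(Real.pi / 2)) (-(Real.pi / 2) + Real.pi) →
      (Real.cos y ≠ 0 → synth 0 c1 t y ≠ 0) ∧
      (Real.cos y = 0 → synth (0 + Real.pi / 2) (dy c) t y ≠ 0) := fun y hy => by
    have hy' : |y| ≤ Real.pi / 2 := abs_le.2 ⟨hy.1.le, by linarith [hy.2]⟩
    refine ⟨fun hc => ?_, fun hc => ?_⟩
    · obtain ⟨κ, hκ, hle⟩ := h.exists_mul_cos_le_deriv hs t
      have := (cos_nonneg_of_abs_le hy').lt_of_ne' hc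
      exact ((mul_pos hκ this).trans_le (hle y hy')).ne'
    · have hyp : y = Real.pi / 2 := by
        by_contra hne
        have : y < Real.pi / 2 := lt_of_le_of_ne (by linarith [hy.2]) hne
        exact (Real.cos_pos_of_mem_Ioo ⟨hy.1, this⟩).ne' hc
      rw [hyp]
      obtain ⟨κ, hκ, hle⟩ := h.exists_mul_cos_le hs t
      have hd := (hasDerivAt_synth_snd (h.good 0).rapid (h.good1 0).rapid h.d0 0 t
        (Real.pi / 2)).sub ((Real.hasDerivAt_cos (Real.pi / 2)).const_mul κ)
      have hmin : ∀ᶠ z in 𝓝[<] (Real.pi / 2), (fun z => synth 0 c t z - κ * Real.cos z)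
          (Real.pi / 2) ≤ (fun z => synth 0 c t z - κ * Real.cos z) z := by
        filter_upwards [Ioo_mem_nhdsLT (show (0 : ℝ) < Real.pi / 2 by positivity)] with z hz
        have h1 := hle z (abs_le.2 ⟨by linarith [hz.1, Real.pi_pos], hz.2.le⟩)
        simp only [synth_pi_div_two h.odd, Real.cos_pi_div_two]
        linarith
      have hneg : synth (0 + Real.pi / 2) (dy c) t (Real.pi / 2)
          - κ * -Real.sin (Real.pi / 2) ≤ 0 := by
        refine le_of_tendsto (hasDerivAt_iff_tendsto_slope_left_right.1 hd).1 ?_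
        filter_upwards [hmin, self_mem_nhdsWithin] with z hz hz'
        rw [slope_def_field]
        exact div_nonpos_of_nonneg_of_nonpos (sub_nonneg.2 hz) (sub_nonpos.2 (le_of_lt hz'))
      rw [Real.sin_pi_div_two] at hneg
      exact (by linarith : synth (0 + Real.pi / 2) (dy c) t (Real.pi / 2) < 0).ne
  have hper : Function.Periodic (fun y => (Real.cos y ≠ 0 → synth 0 c1 t y ≠ 0) ∧
      (Real.cos y = 0 → synth (0 + Real.pi / 2) (dy c) t y ≠ 0)) Real.pi := fun y => by
    simp only [synth_add_pi h.odd1, synth_add_pi hodd, Real.cos_add_pi, neg_ne_zero, neg_eq_zero]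
  obtain ⟨y', hy', he⟩ := hper.exists_mem_Ioc Real.pi_pos y (-(Real.pi / 2))
  exact he.mpr (key y' hy')

open ContinuousLinearMap in
lemma pd_eq {f : ℝ × ℝ → ℝ} {A B : ℝ} {q : ℝ × ℝ}
    (h : HasFDerivAt f (A • fst ℝ ℝ ℝ + B • snd ℝ ℝ ℝ) q) : pd1 f q = A ∧ pd2 f q = B := by
  unfold pd1 pd2
  rw [h.fderiv]
  constructor <;> simp

/-- The Fourier series with coefficients `c`, stretched in the first coordinate. -/
noncomputable def stretch (ε θ : ℝ) (c : Seq) (q : ℝ × ℝ) : ℝ := synth θ c (ε * q.1) q.2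

open ContinuousLinearMap in
lemma hasFDerivAt_stretch {c c' : Seq} (hc : Rapid c) (hc1 : Rapid c')
    (h : ∀ m t, HasDerivAt (c m) (c' m t) t) (ε θ : ℝ) (q : ℝ × ℝ) :
    HasFDerivAt (stretch ε θ c) ((ε * stretch ε θ c' q) • fst ℝ ℝ ℝ
      + stretch ε (θ + Real.pi / 2) (dy c) q • snd ℝ ℝ ℝ) q := by
  have h1 : HasFDerivAt (fun q : ℝ × ℝ => (ε * q.1, q.2))
      ((ε • fst ℝ ℝ ℝ).prod (snd ℝ ℝ ℝ)) q :=
    (hasFDerivAt_fst.const_mul ε).prodMk hasFDerivAt_snd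
  refine ((hasFDerivAt_synth hc hc1 h θ (ε * q.1, q.2)).comp q h1).congr_fderiv ?_
  ext <;> simp [stretch, mul_comm]

lemma contDiff_stretch {c : Seq} (hc : ∀ n, Good n c) (ε θ : ℝ) :
    ContDiff ℝ (⊤ : ℕ∞) (stretch ε θ c) := by
  have h : ContDiff ℝ (⊤ : ℕ∞) fun p : ℝ × ℝ => synth θ c p.1 p.2 :=
    contDiff_infty.2 fun n => contDiff_synth (hc n) θ
  exact h.comp (g := fun p : ℝ × ℝ => synth θ c p.1 p.2) (f := fun q : ℝ × ℝ => (ε * q.1, q.2))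
    (by fun_prop)

/-- The velocity field with stream function `stretch ε 0 c`. -/
noncomputable def velocity (ε : ℝ) (c c1 : Seq) (q : ℝ × ℝ) : ℝ × ℝ :=
  (stretch ε (0 + Real.pi / 2) (dy c) q, -(ε * stretch ε 0 c1 q))

/-- The pressure given by Bernoulli's law. -/
noncomputable def pressure (ε μ : ℝ) (c c1 : Seq) (q : ℝ × ℝ) : ℝ :=
  -(stretch ε (0 + Real.pi / 2) (dy c) q ^ 2 + (ε * stretch ε 0 c1 q) ^ 2) / 2
    + (-(stretch ε 0 c q ^ 2) / 2 + ε ^ 2 * (stretch ε 0 c q ^ 2 / 2 - 4 / 3 * stretch ε 0 c q ^ 4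
      + 4 / 5 * (1 + μ) * stretch ε 0 c q ^ 6))

lemma contDiff_pressure (h : ∀ n, Good n c) (h1 : ∀ n, Good n c1) :
    ContDiff ℝ (⊤ : ℕ∞) (pressure ε μ c c1) := by
  have e0 := contDiff_stretch h ε 0
  have e1 := contDiff_stretch h1 ε 0
  have e2 := contDiff_stretch (fun n => (h n).dy) ε (0 + Real.pi / 2)
  unfold pressure
  fun_prop

lemma contDiff_velocity (h : ∀ n, Good n c) (h1 : ∀ n, Good n c1) :
    ContDiff ℝ (⊤ : ℕ∞) (velocity ε c c1) :=
  (contDiff_stretch (fun n => (h n).dy) ε (0 + Real.pi / 2)).prodMk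
    (contDiff_const.mul (contDiff_stretch h1 ε 0)).neg

lemma exists_norm_velocity_le (h : Rapid c) (h1 : Rapid c1) :
    ∃ M : ℝ, ∀ q, ‖velocity ε c c1 q‖ ≤ M := by
  obtain ⟨B, hB⟩ := h.dy.exists_abs_synth_le
  obtain ⟨B1, hB1⟩ := h1.exists_abs_synth_le
  refine ⟨max B (|ε| * B1), fun q => max_le_max (hB _ _ _) ?_⟩
  change |-(ε * stretch ε 0 c1 q)| ≤ _
  rw [abs_neg, abs_mul]
  exact mul_le_mul_of_nonneg_left (hB1 _ _ _) (abs_nonneg ε)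

open ContinuousLinearMap

lemma Modes.hasFDerivAt_fst (h : Modes ε μ E c c1 c2 c3) (q : ℝ × ℝ) :
    HasFDerivAt (fun z => (velocity ε c c1 z).1)
      ((ε * stretch ε (0 + Real.pi / 2) (dy c1) q) • fst ℝ ℝ ℝ
        + stretch ε (0 + Real.pi / 2 + Real.pi / 2) (dy (dy c)) q • snd ℝ ℝ ℝ) q :=
  hasFDerivAt_stretch (h.good 0).rapid.dy (h.good1 0).rapid.dy
    (fun m t => (h.d0 m t).const_mul (m : ℝ)) ε _ q

lemma Modes.hasFDerivAt_snd (h : Modes ε μ E c c1 c2 c3) (q : ℝ × ℝ) :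
    HasFDerivAt (fun z => (velocity ε c c1 z).2)
      ((-(ε ^ 2 * stretch ε 0 c2 q)) • fst ℝ ℝ ℝ
        + (-(ε * stretch ε (0 + Real.pi / 2) (dy c1) q)) • snd ℝ ℝ ℝ) q := by
  refine ((hasFDerivAt_stretch (h.good1 0).rapid h.rapid2 h.d1 ε 0 q).const_mul
    ε).neg.congr_fderiv ?_
  ext <;> simp; ring

lemma Modes.stretch_eq (h : Modes ε μ E c c1 c2 c3) (q : ℝ × ℝ) (hε : ε ≠ 0) :
    ε ^ 2 * stretch ε 0 c2 q + stretch ε (0 + Real.pi / 2 + Real.pi / 2) (dy (dy c)) q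
    = -stretch ε 0 c q + ε ^ 2 * (stretch ε 0 c q - 16 / 3 * stretch ε 0 c q ^ 3
      + 24 / 5 * (1 + μ) * stretch ε 0 c q ^ 5) := by
  have := synth_eq hε (h.good 0).rapid h.even h.eq (ε * q.1) q.2
  unfold stretch
  linarith

lemma Modes.hasFDerivAt_pressure (h : Modes ε μ E c c1 c2 c3) (q : ℝ × ℝ) (hε : ε ≠ 0) :
    HasFDerivAt (pressure ε μ c c1)
      ((-((velocity ε c c1 q).1 * (ε * stretch ε (0 + Real.pi / 2) (dy c1) q)
        + (velocity ε c c1 q).2 * stretch ε (0 + Real.pi / 2 + Real.pi / 2) (dy (dy c)) q))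
          • fst ℝ ℝ ℝ
        + (-((velocity ε c c1 q).1 * (-(ε ^ 2 * stretch ε 0 c2 q))
        + (velocity ε c c1 q).2 * (-(ε * stretch ε (0 + Real.pi / 2) (dy c1) q))))
          • snd ℝ ℝ ℝ) q := by
  have e0 := hasFDerivAt_stretch (h.good 0).rapid (h.good1 0).rapid h.d0 ε 0 q
  have e1 := h.hasFDerivAt_fst q
  have e2 := (hasFDerivAt_stretch (h.good1 0).rapid h.rapid2 h.d1 ε 0 q).const_mul ε
  have hh := h.stretch_eq q hε
  have e3 : ∀ s : ℝ, HasDerivAt (fun s => -(s ^ 2) / 2 + ε ^ 2 * (s ^ 2 / 2 - 4 / 3 * s ^ 4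
      + 4 / 5 * (1 + μ) * s ^ 6)) (-s + ε ^ 2 * (s - 16 / 3 * s ^ 3
      + 24 / 5 * (1 + μ) * s ^ 5)) s := fun s => by
    refine (((hasDerivAt_pow 2 s).neg.div_const 2).add (((((hasDerivAt_pow 2 s).div_const 2).sub
      ((hasDerivAt_pow 4 s).const_mul (4 / 3))).add
      ((hasDerivAt_pow 6 s).const_mul (4 / 5 * (1 + μ)))).const_mul (ε ^ 2))).congr_deriv ?_
    push_cast; ring
  have e4 := (e3 (stretch ε 0 c q)).comp_hasFDerivAt q e0
  rw [← hh] at e4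
  have e5 : ∀ s : ℝ, HasDerivAt (fun s => s ^ 2) (2 * s) s := fun s => by
    simpa using hasDerivAt_pow 2 s
  have e6 := ((((e5 _).comp_hasFDerivAt q e1).add ((e5 _).comp_hasFDerivAt q e2)).const_mul
    (-(1 / 2) : ℝ)).add e4
  have e7 : pressure ε μ c c1 = fun z => -(1 / 2) * ((velocity ε c c1 z).1 ^ 2
      + (ε * stretch ε 0 c1 z) ^ 2) + (-(stretch ε 0 c z ^ 2) / 2
      + ε ^ 2 * (stretch ε 0 c z ^ 2 / 2 - 4 / 3 * stretch ε 0 c z ^ 4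
      + 4 / 5 * (1 + μ) * stretch ε 0 c z ^ 6)) := funext fun z => by
    unfold pressure velocity; ring
  rw [e7]
  refine HasFDerivAt.congr_fderiv e6 ?_
  ext <;> simp [velocity] <;> ring

lemma Modes.velocity_ne_zero (h : Modes ε μ E c c1 c2 c3) {T : ℝ}
    (hs : Small ε μ (E * sumConst) T) (q : ℝ × ℝ) : velocity ε c c1 q ≠ 0 := fun h0 => by
  obtain ⟨e1, e2⟩ := h.deriv_ne_zero hs (ε * q.1) q.2
  obtain ⟨h1, h2⟩ := Prod.mk_eq_zero.1 h0
  have h2' : stretch ε 0 c1 q = 0 :=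
    (mul_eq_zero.1 (neg_eq_zero.1 h2)).resolve_left hs.eps_pos.ne'
  by_cases hc : Real.cos q.2 = 0
  · exact e2 hc h1
  · exact e1 hc h2'

lemma Modes.velocity_pi_div_two (h : Modes ε μ E c c1 c2 c3) (x : ℝ) :
    (velocity ε c c1 (x, Real.pi / 2)).2 = 0 := by
  change -(ε * synth 0 c1 (ε * x) (Real.pi / 2)) = 0
  rw [synth_pi_div_two h.odd1, mul_zero, neg_zero]

lemma Modes.velocity_zero (h : Modes ε μ E c c1 c2 c3) (x : ℝ) :
    (velocity ε c c1 (x, 0)).1 = 0 := by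
  have h1 := hasDerivAt_synth_snd (h.good 0).rapid (h.good1 0).rapid h.d0 0 (ε * x) 0
  have h2 : HasDerivAt (fun y => synth 0 c (ε * x) (-y))
      (-synth (0 + Real.pi / 2) (dy c) (ε * x) 0) 0 := by
    have h3 : HasDerivAt (fun y => synth 0 c (ε * x) y)
        (synth (0 + Real.pi / 2) (dy c) (ε * x) 0) (-0) := by rwa [neg_zero]
    refine (h3.comp (0 : ℝ) (hasDerivAt_neg 0)).congr_deriv ?_
    simp
  simp only [synth_neg] at h2
  have := h1.unique h2
  change synth (0 + Real.pi / 2) (dy c) (ε * x) 0 = 0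
  linarith

lemma Modes.velocity_not_shear (h : Modes ε μ E c c1 c2 c3) {T : ℝ}
    (hs : Small ε μ (E * sumConst) T) :
    ¬ ∃ e : ℝ × ℝ, ‖e‖ = 1 ∧ ∃ V : ℝ → ℝ, ∀ q : ℝ × ℝ, velocity ε c c1 q =
      (V (q.1 * (-e.2) + q.2 * e.1) * e.1, V (q.1 * (-e.2) + q.2 * e.1) * e.2) := by
  rintro ⟨e, -, V, hV⟩
  have key : ∀ q, velocity ε c c1 q ≠ 0 := h.velocity_ne_zero hs
  have h1 := h.velocity_pi_div_two 0
  have h2 := h.velocity_zero 0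
  have k1 := key (0, Real.pi / 2)
  have k2 := key (0, 0)
  rw [hV] at h1 h2 k1 k2
  rcases mul_eq_zero.1 h1 with h1 | h1
  · exact k1 (by rw [h1, zero_mul, zero_mul]; rfl)
  rcases mul_eq_zero.1 h2 with h2 | h2
  · exact k2 (by rw [h2, zero_mul, zero_mul]; rfl)
  · exact k1 (by rw [h1, h2, mul_zero]; rfl)

end EulerPlane

open EulerPlane

/-- there are a bounded smooth velocity field `𝐮` and a smooth pressure `p`
solving the stationary Euler equations in the whole plane, with `𝐮` nowhere vanishing and not
a shear flow. -/
theorem euler_plane_no_stagnation_not_shear :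
    ∃ U : ℝ × ℝ → ℝ × ℝ, ∃ p : ℝ × ℝ → ℝ,
      ContDiff ℝ (⊤ : ℕ∞) U ∧ ContDiff ℝ (⊤ : ℕ∞) p ∧
      (∃ M : ℝ, ∀ q : ℝ × ℝ, ‖U q‖ ≤ M) ∧
      (∀ q : ℝ × ℝ,
        pd1 (fun z => (U z).1) q + pd2 (fun z => (U z).2) q = 0) ∧
      (∀ q : ℝ × ℝ,
        (U q).1 * pd1 (fun z => (U z).1) q + (U q).2 * pd2 (fun z => (U z).1) q
          = -(pd1 p q) ∧
        (U q).1 * pd1 (fun z => (U z).2) q + (U q).2 * pd2 (fun z => (U z).2) q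
          = -(pd2 p q)) ∧
      (∀ q : ℝ × ℝ, U q ≠ 0) ∧
      ¬ ∃ e : ℝ × ℝ, ‖e‖ = 1 ∧ ∃ V : ℝ → ℝ,
        ∀ q : ℝ × ℝ, U q = (V (q.1 * (-e.2) + q.2 * e.1) * e.1,
                             V (q.1 * (-e.2) + q.2 * e.1) * e.2) := by
  obtain ⟨K, ε₀, hK, hε₀, hmodes⟩ := exists_modes
  obtain ⟨ε, T, hε, hεε, hsmall⟩ := exists_small hK hε₀
  obtain ⟨μ, c, c1, c2, c3, hμ, h⟩ := hmodes ε hε hεε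
  have hs := hsmall μ hμ
  refine ⟨velocity ε c c1, pressure ε μ c c1, contDiff_velocity h.good h.good1,
    contDiff_pressure h.good h.good1, exists_norm_velocity_le (h.good 0).rapid (h.good1 0).rapid,
    fun q => ?_, fun q => ?_, h.velocity_ne_zero hs, h.velocity_not_shear hs⟩
  all_goals
    obtain ⟨a1, a2⟩ := pd_eq (h.hasFDerivAt_fst q)
    obtain ⟨b1, b2⟩ := pd_eq (h.hasFDerivAt_snd q)
    obtain ⟨p1, p2⟩ := pd_eq (h.hasFDerivAt_pressure q hε.ne')
  · rw [a1, b2, add_neg_cancel]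
  · rw [a1, a2, b1, b2, p1, p2, neg_neg, neg_neg]
    exact ⟨rfl, rfl⟩
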